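/- arXiv:math/0504057 — 2 statements merged into one kernel-verified Lean document; each statement's English description precedes it below -/
import Mathlib

section
/- Let n ≥ 1, Q = 2n + 2 and 1 < p < Q. The constant ((Q−p)/p)^p in the Heisenberg L^p Hardy inequality is sharp: the infimum, over all φ ∈ C_c^∞(ℝ^{2n+1} \ {0}) with ∫ (|z|^p/(|z|⁴+t²)^{p/2})|φ|^p dz dt ≠ 0, of the quotient (∫_{ℝ^{2n+1}} ‖∇_H φ‖^p dz dt) / (∫_{ℝ^{2n+1}} (|z|^p/(|z|⁴+t²)^{p/2}) |φ|^p dz dt) equals ((Q−p)/p)^p. -/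
open MeasureTheory

/-- A point of the Heisenberg group `Hⁿ ≅ ℝⁿ × ℝⁿ × ℝ`, coordinates `(x, y, t)`. -/
abbrev Heisenberg (n : ℕ) :=
  EuclideanSpace ℝ (Fin n) × EuclideanSpace ℝ (Fin n) × ℝ

/-- The horizontal vector field `X_j = ∂/∂x_j + 2 y_j ∂/∂t` applied to `f`. -/
noncomputable def heisX {n : ℕ} (j : Fin n) (f : Heisenberg n → ℝ)
    (q : Heisenberg n) : ℝ :=
  fderiv ℝ f q (EuclideanSpace.single j 1, 0, 2 * q.2.1 j)

/-- The horizontal vector field `Y_j = ∂/∂y_j − 2 x_j ∂/∂t` applied to `f`. -/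
noncomputable def heisY {n : ℕ} (j : Fin n) (f : Heisenberg n → ℝ)
    (q : Heisenberg n) : ℝ :=
  fderiv ℝ f q (0, EuclideanSpace.single j 1, -(2 * q.1 j))

/-- Squared norm of the horizontal gradient `∇_H f = (X₁f,…,Xₙf,Y₁f,…,Yₙf)`. -/
noncomputable def heisGradSq {n : ℕ} (f : Heisenberg n → ℝ)
    (q : Heisenberg n) : ℝ :=
  ∑ j : Fin n, ((heisX j f q) ^ 2 + (heisY j f q) ^ 2)

/-- The homogeneous norm `ρ(z,t) = (|z|⁴ + t²)^{1/4}` with `|z|² = ‖x‖² + ‖y‖²`. -/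
noncomputable def heisRho {n : ℕ} (q : Heisenberg n) : ℝ :=
  ((‖q.1‖ ^ 2 + ‖q.2.1‖ ^ 2) ^ 2 + q.2.2 ^ 2) ^ ((1 : ℝ) / 4)

open Filter Topology

/-- The squared Euclidean norm `|z|²` of the horizontal part. -/
noncomputable def heisS {n : ℕ} (q : Heisenberg n) : ℝ := ‖q.1‖ ^ 2 + ‖q.2.1‖ ^ 2

/-- The fourth power `|z|⁴ + t²` of the homogeneous norm. -/
noncomputable def heisN {n : ℕ} (q : Heisenberg n) : ℝ := heisS q ^ 2 + q.2.2 ^ 2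

/-- The pairing of `∇_H u` with the horizontal field `|z|² z + t J z`. -/
noncomputable def heisW {n : ℕ} (u : Heisenberg n → ℝ) (q : Heisenberg n) : ℝ :=
  ∑ j : Fin n, ((heisS q * q.1 j + q.2.2 * q.2.1 j) * heisX j u q +
    (heisS q * q.2.1 j - q.2.2 * q.1 j) * heisY j u q)

section Basic

variable {n : ℕ}

lemma heisS_nonneg (q : Heisenberg n) : 0 ≤ heisS q := by
  unfold heisS; positivity

lemma heisN_nonneg (q : Heisenberg n) : 0 ≤ heisN q := by
  unfold heisN; positivity

lemma heisN_pos {q : Heisenberg n} (hq : q ≠ 0) : 0 < heisN q := by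
  refine lt_of_le_of_ne (heisN_nonneg q) fun h => hq ?_
  have hS := heisS_nonneg q
  have h1 : heisS q = 0 := by
    unfold heisN at h; nlinarith [sq_nonneg (heisS q), sq_nonneg q.2.2]
  have h2 : q.2.2 = 0 := by
    unfold heisN at h; nlinarith [sq_nonneg (heisS q), sq_nonneg q.2.2]
  unfold heisS at h1
  have h3 : ‖q.1‖ = 0 := by nlinarith [sq_nonneg ‖q.1‖, sq_nonneg ‖q.2.1‖]
  have h4 : ‖q.2.1‖ = 0 := by nlinarith [sq_nonneg ‖q.1‖, sq_nonneg ‖q.2.1‖]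
  exact Prod.ext (norm_eq_zero.1 h3) (Prod.ext (norm_eq_zero.1 h4) h2)

lemma heisS_sq_le_heisN (q : Heisenberg n) : heisS q ^ 2 ≤ heisN q := by
  unfold heisN; nlinarith [sq_nonneg q.2.2]

lemma sum_sq_eq_heisS (q : Heisenberg n) : ∑ j : Fin n, (q.1 j ^ 2 + q.2.1 j ^ 2) = heisS q := by
  rw [Finset.sum_add_distrib, heisS, EuclideanSpace.real_norm_sq_eq,
    EuclideanSpace.real_norm_sq_eq]

lemma contDiff_heisS {k : WithTop ℕ∞} : ContDiff ℝ k (heisS : Heisenberg n → ℝ) := by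
  unfold heisS
  exact (contDiff_fst.norm_sq ℝ).add ((contDiff_fst.comp contDiff_snd).norm_sq ℝ)

lemma contDiff_height {k : WithTop ℕ∞} : ContDiff ℝ k (fun q : Heisenberg n => q.2.2) :=
  contDiff_snd.comp contDiff_snd

lemma contDiff_coord_fst {k : WithTop ℕ∞} (j : Fin n) :
    ContDiff ℝ k (fun q : Heisenberg n => q.1 j) :=
  (EuclideanSpace.proj (𝕜 := ℝ) j).contDiff.comp contDiff_fst

lemma contDiff_coord_snd {k : WithTop ℕ∞} (j : Fin n) :
    ContDiff ℝ k (fun q : Heisenberg n => q.2.1 j) :=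
  (EuclideanSpace.proj (𝕜 := ℝ) j).contDiff.comp (contDiff_fst.comp contDiff_snd)

lemma contDiff_heisN {k : WithTop ℕ∞} : ContDiff ℝ k (heisN : Heisenberg n → ℝ) := by
  unfold heisN
  exact (contDiff_heisS.pow 2).add (contDiff_height.pow 2)

lemma fderiv_height (q v : Heisenberg n) :
    fderiv ℝ (fun q : Heisenberg n => q.2.2) q v = v.2.2 := by
  have : HasFDerivAt (fun q : Heisenberg n => q.2.2)
      ((ContinuousLinearMap.snd ℝ _ _).comp (ContinuousLinearMap.snd ℝ _ _)) q :=
    hasFDerivAt_snd.comp q hasFDerivAt_snd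
  rw [this.fderiv]; rfl

lemma fderiv_coord_fst (j : Fin n) (q v : Heisenberg n) :
    fderiv ℝ (fun q : Heisenberg n => q.1 j) q v = v.1 j := by
  have : HasFDerivAt (fun q : Heisenberg n => q.1 j)
      ((EuclideanSpace.proj (𝕜 := ℝ) j).comp (ContinuousLinearMap.fst ℝ _ _)) q :=
    (EuclideanSpace.proj (𝕜 := ℝ) j).hasFDerivAt.comp q hasFDerivAt_fst
  rw [this.fderiv]; rfl

lemma fderiv_coord_snd (j : Fin n) (q v : Heisenberg n) :
    fderiv ℝ (fun q : Heisenberg n => q.2.1 j) q v = v.2.1 j := by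
  have : HasFDerivAt (fun q : Heisenberg n => q.2.1 j)
      ((EuclideanSpace.proj (𝕜 := ℝ) j).comp
        ((ContinuousLinearMap.fst ℝ _ _).comp (ContinuousLinearMap.snd ℝ _ _))) q :=
    (EuclideanSpace.proj (𝕜 := ℝ) j).hasFDerivAt.comp q
      (hasFDerivAt_fst.comp q hasFDerivAt_snd)
  rw [this.fderiv]; rfl

lemma fderiv_heisS (q v : Heisenberg n) :
    fderiv ℝ heisS q v = 2 * (inner ℝ q.1 v.1 + inner ℝ q.2.1 v.2.1) := by
  have h1 : HasFDerivAt (fun q : Heisenberg n => q.1) (ContinuousLinearMap.fst ℝ _ _) q :=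
    hasFDerivAt_fst
  have h2 : HasFDerivAt (fun q : Heisenberg n => q.2.1)
      ((ContinuousLinearMap.fst ℝ _ _).comp (ContinuousLinearMap.snd ℝ _ _)) q :=
    hasFDerivAt_fst.comp q hasFDerivAt_snd
  have : HasFDerivAt (heisS : Heisenberg n → ℝ) _ q := h1.norm_sq.add h2.norm_sq
  rw [this.fderiv]
  simp
  ring

lemma heisX_heisS (j : Fin n) (q : Heisenberg n) : heisX j heisS q = 2 * q.1 j := by
  simp [heisX, fderiv_heisS, EuclideanSpace.inner_single_right]

lemma heisY_heisS (j : Fin n) (q : Heisenberg n) : heisY j heisS q = 2 * q.2.1 j := by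
  simp [heisY, fderiv_heisS, EuclideanSpace.inner_single_right]

lemma heisX_height (j : Fin n) (q : Heisenberg n) :
    heisX j (fun q => q.2.2) q = 2 * q.2.1 j := by
  simp [heisX, fderiv_height]

lemma heisY_height (j : Fin n) (q : Heisenberg n) :
    heisY j (fun q => q.2.2) q = -(2 * q.1 j) := by
  simp [heisY, fderiv_height]

lemma heisX_coord_fst (j : Fin n) (q : Heisenberg n) : heisX j (fun q => q.1 j) q = 1 := by
  simp [heisX, fderiv_coord_fst]

lemma heisX_coord_snd (j : Fin n) (q : Heisenberg n) : heisX j (fun q => q.2.1 j) q = 0 := by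
  simp [heisX, fderiv_coord_snd]

lemma heisY_coord_fst (j : Fin n) (q : Heisenberg n) : heisY j (fun q => q.1 j) q = 0 := by
  simp [heisY, fderiv_coord_fst]

lemma heisY_coord_snd (j : Fin n) (q : Heisenberg n) : heisY j (fun q => q.2.1 j) q = 1 := by
  simp [heisY, fderiv_coord_snd]

section Rules

variable {f g : Heisenberg n → ℝ} {q : Heisenberg n} (j : Fin n)

lemma heisX_mul (hf : DifferentiableAt ℝ f q) (hg : DifferentiableAt ℝ g q) :
    heisX j (fun q => f q * g q) q = heisX j f q * g q + f q * heisX j g q := by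
  simp only [heisX]
  rw [fderiv_fun_mul hf hg]
  simp
  ring

lemma heisY_mul (hf : DifferentiableAt ℝ f q) (hg : DifferentiableAt ℝ g q) :
    heisY j (fun q => f q * g q) q = heisY j f q * g q + f q * heisY j g q := by
  simp only [heisY]
  rw [fderiv_fun_mul hf hg]
  simp
  ring

lemma heisX_add (hf : DifferentiableAt ℝ f q) (hg : DifferentiableAt ℝ g q) :
    heisX j (fun q => f q + g q) q = heisX j f q + heisX j g q := by
  simp only [heisX]
  rw [fderiv_fun_add hf hg]
  simp

lemma heisY_add (hf : DifferentiableAt ℝ f q) (hg : DifferentiableAt ℝ g q) :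
    heisY j (fun q => f q + g q) q = heisY j f q + heisY j g q := by
  simp only [heisY]
  rw [fderiv_fun_add hf hg]
  simp

lemma heisY_sub (hf : DifferentiableAt ℝ f q) (hg : DifferentiableAt ℝ g q) :
    heisY j (fun q => f q - g q) q = heisY j f q - heisY j g q := by
  simp only [heisY]
  rw [fderiv_fun_sub hf hg]
  simp

lemma heisX_comp {h : ℝ → ℝ} {h' : ℝ} (hh : HasDerivAt h h' (f q))
    (hf : DifferentiableAt ℝ f q) : heisX j (fun q => h (f q)) q = h' * heisX j f q := by
  have := hh.comp_hasFDerivAt q hf.hasFDerivAt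
  simp only [heisX]
  rw [show (fun q => h (f q)) = h ∘ f from rfl, this.fderiv]
  simp

lemma heisY_comp {h : ℝ → ℝ} {h' : ℝ} (hh : HasDerivAt h h' (f q))
    (hf : DifferentiableAt ℝ f q) : heisY j (fun q => h (f q)) q = h' * heisY j f q := by
  have := hh.comp_hasFDerivAt q hf.hasFDerivAt
  simp only [heisY]
  rw [show (fun q => h (f q)) = h ∘ f from rfl, this.fderiv]
  simp

end Rules

lemma heisX_heisN (j : Fin n) (q : Heisenberg n) :
    heisX j heisN q = 4 * (heisS q * q.1 j + q.2.2 * q.2.1 j) := by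
  have hS : DifferentiableAt ℝ (heisS : Heisenberg n → ℝ) q :=
    contDiff_heisS.contDiffAt.differentiableAt one_ne_zero
  have ht : DifferentiableAt ℝ (fun q : Heisenberg n => q.2.2) q :=
    contDiff_height.contDiffAt.differentiableAt one_ne_zero
  have e : (heisN : Heisenberg n → ℝ) = fun q => heisS q * heisS q + q.2.2 * q.2.2 := by
    ext q; simp only [heisN]; ring
  rw [e, heisX_add j (hS.fun_mul hS) (ht.fun_mul ht), heisX_mul j hS hS, heisX_mul j ht ht,
    heisX_heisS, heisX_height]
  ring

lemma heisY_heisN (j : Fin n) (q : Heisenberg n) :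
    heisY j heisN q = 4 * (heisS q * q.2.1 j - q.2.2 * q.1 j) := by
  have hS : DifferentiableAt ℝ (heisS : Heisenberg n → ℝ) q :=
    contDiff_heisS.contDiffAt.differentiableAt one_ne_zero
  have ht : DifferentiableAt ℝ (fun q : Heisenberg n => q.2.2) q :=
    contDiff_height.contDiffAt.differentiableAt one_ne_zero
  have e : (heisN : Heisenberg n → ℝ) = fun q => heisS q * heisS q + q.2.2 * q.2.2 := by
    ext q; simp only [heisN]; ring
  rw [e, heisY_add j (hS.fun_mul hS) (ht.fun_mul ht), heisY_mul j hS hS, heisY_mul j ht ht,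
    heisY_heisS, heisY_height]
  ring

lemma sum_field_sq (q : Heisenberg n) :
    ∑ j : Fin n, ((heisS q * q.1 j + q.2.2 * q.2.1 j) ^ 2 +
      (heisS q * q.2.1 j - q.2.2 * q.1 j) ^ 2) = heisS q * heisN q := by
  rw [mul_comm, ← sum_sq_eq_heisS q, Finset.mul_sum]
  refine Finset.sum_congr rfl fun j _ => ?_
  rw [heisN, ← sum_sq_eq_heisS q]
  ring

lemma heisW_sq_le (u : Heisenberg n → ℝ) (q : Heisenberg n) :
    heisW u q ^ 2 ≤ heisS q * heisN q * heisGradSq u q := by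
  have := Finset.sum_mul_sq_le_sq_mul_sq (Finset.univ : Finset (Fin n ⊕ Fin n))
    (Sum.elim (fun j => heisS q * q.1 j + q.2.2 * q.2.1 j)
      (fun j => heisS q * q.2.1 j - q.2.2 * q.1 j))
    (Sum.elim (fun j => heisX j u q) (fun j => heisY j u q))
  simp only [Fintype.sum_sum_type, Sum.elim_inl, Sum.elim_inr, ← Finset.sum_add_distrib] at this
  rwa [sum_field_sq] at this

lemma abs_heisW_le (u : Heisenberg n → ℝ) (q : Heisenberg n) :
    |heisW u q| ≤ √(heisS q) * √(heisN q) * √(heisGradSq u q) := by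
  rw [← Real.sqrt_mul (heisS_nonneg q), ← Real.sqrt_mul
    (mul_nonneg (heisS_nonneg q) (heisN_nonneg q))]
  exact Real.abs_le_sqrt (heisW_sq_le u q)

end Basic

section LowerBound

variable {n : ℕ}

instance isAddHaarMeasure_volume_heisenberg :
    (volume : Measure (Heisenberg n)).IsAddHaarMeasure := by
  have : (volume : Measure (EuclideanSpace ℝ (Fin n) × ℝ)).IsAddHaarMeasure :=
    Measure.prod.instIsAddHaarMeasure _ _
  exact Measure.prod.instIsAddHaarMeasure _ _

lemma ae_ne_zero_heisenberg : ∀ᵐ q : Heisenberg n, q ≠ 0 := by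
  have := Module.punctured_nhds_neBot ℝ (Heisenberg n) 0
  simp [ae_iff]

lemma integrable_of_continuousOn_support_subset {f : Heisenberg n → ℝ} {K : Set (Heisenberg n)}
    (hK : IsCompact K) (hf : ContinuousOn f K) (hs : ∀ q ∉ K, f q = 0) : Integrable f := by
  rw [← integrableOn_iff_integrable_of_support_subset
    (Function.support_subset_iff'.2 hs : Function.support f ⊆ K)]
  exact hf.integrableOn_compact hK

lemma integral_fderiv_apply_eq_zero {f : Heisenberg n → ℝ} (hf : ContDiff ℝ 1 f)
    (hc : HasCompactSupport f) (v : Heisenberg n) : ∫ q, fderiv ℝ f q v = 0 := by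
  have hd : Continuous fun q => fderiv ℝ f q v :=
    (hf.continuous_fderiv one_ne_zero).clm_apply continuous_const
  have hi : Integrable fun q => fderiv ℝ f q v :=
    hd.integrable_of_hasCompactSupport (hc.fderiv_apply ℝ v)
  have := integral_mul_fderiv_eq_neg_fderiv_mul_of_integrable (μ := (volume : Measure (Heisenberg n)))
    (f := fun _ => (1 : ℝ)) (g := f) (v := v) (by simp) (by simpa using hi)
    (by simpa using hf.continuous.integrable_of_hasCompactSupport hc) (by simp)
    (fun q _ => hf.contDiffAt.differentiableAt one_ne_zero)
  simpa using this

lemma heisX_eq (j : Fin n) (f : Heisenberg n → ℝ) (hf : Differentiable ℝ f) (q : Heisenberg n) :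
    heisX j f q = fderiv ℝ f q (EuclideanSpace.single j 1, 0, 0) +
      fderiv ℝ (fun q : Heisenberg n => (2 * q.2.1 j) * f q) q (0, 0, 1) := by
  have hy : DifferentiableAt ℝ (fun q : Heisenberg n => q.2.1 j) q :=
    (contDiff_coord_snd j).contDiffAt.differentiableAt one_ne_zero
  rw [fderiv_fun_mul (hy.const_mul 2) (hf q), fderiv_const_mul hy, heisX]
  have e : ((EuclideanSpace.single j 1, 0, 2 * q.2.1 j) : Heisenberg n) =
      (EuclideanSpace.single j 1, 0, 0) + (2 * q.2.1 j) • (0, 0, 1) := by simp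
  rw [e, map_add, map_smul]
  simp [fderiv_coord_snd]

lemma heisY_eq (j : Fin n) (f : Heisenberg n → ℝ) (hf : Differentiable ℝ f) (q : Heisenberg n) :
    heisY j f q = fderiv ℝ f q (0, EuclideanSpace.single j 1, 0) +
      fderiv ℝ (fun q : Heisenberg n => (-2 * q.1 j) * f q) q (0, 0, 1) := by
  have hy : DifferentiableAt ℝ (fun q : Heisenberg n => q.1 j) q :=
    (contDiff_coord_fst j).contDiffAt.differentiableAt one_ne_zero
  rw [fderiv_fun_mul (hy.const_mul (-2)) (hf q), fderiv_const_mul hy, heisY]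
  have e : ((0, EuclideanSpace.single j 1, -(2 * q.1 j)) : Heisenberg n) =
      (0, EuclideanSpace.single j 1, 0) + (-2 * q.1 j) • (0, 0, 1) := by simp
  rw [e, map_add, map_smul]
  simp [fderiv_coord_fst]

lemma continuous_heisX (j : Fin n) {f : Heisenberg n → ℝ} (hf : ContDiff ℝ 1 f) :
    Continuous (heisX j f) :=
  (hf.continuous_fderiv one_ne_zero).clm_apply (continuous_const.prodMk
    (continuous_const.prodMk ((contDiff_coord_snd (k := 0) j).continuous.const_mul 2)))

lemma continuous_heisY (j : Fin n) {f : Heisenberg n → ℝ} (hf : ContDiff ℝ 1 f) :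
    Continuous (heisY j f) :=
  (hf.continuous_fderiv one_ne_zero).clm_apply (continuous_const.prodMk
    (continuous_const.prodMk ((contDiff_coord_fst (k := 0) j).continuous.const_mul 2).neg))

lemma heisX_eq_zero (j : Fin n) {f : Heisenberg n → ℝ} {q : Heisenberg n} (hq : q ∉ tsupport f) :
    heisX j f q = 0 := by
  have : fderiv ℝ f q = 0 := by
    by_contra h
    exact hq (support_fderiv_subset ℝ h)
  simp [heisX, this]

lemma heisY_eq_zero (j : Fin n) {f : Heisenberg n → ℝ} {q : Heisenberg n} (hq : q ∉ tsupport f) :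
    heisY j f q = 0 := by
  have : fderiv ℝ f q = 0 := by
    by_contra h
    exact hq (support_fderiv_subset ℝ h)
  simp [heisY, this]

lemma integrable_heisX (j : Fin n) {f : Heisenberg n → ℝ} (hf : ContDiff ℝ 1 f)
    (hc : HasCompactSupport f) : Integrable (heisX j f) :=
  integrable_of_continuousOn_support_subset hc (continuous_heisX j hf).continuousOn
    fun _ => heisX_eq_zero j

lemma integrable_heisY (j : Fin n) {f : Heisenberg n → ℝ} (hf : ContDiff ℝ 1 f)
    (hc : HasCompactSupport f) : Integrable (heisY j f) :=
  integrable_of_continuousOn_support_subset hc (continuous_heisY j hf).continuousOn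
    fun _ => heisY_eq_zero j

lemma integrable_fderiv_apply {f : Heisenberg n → ℝ} (hf : ContDiff ℝ 1 f)
    (hc : HasCompactSupport f) (v : Heisenberg n) : Integrable fun q => fderiv ℝ f q v :=
  ((hf.continuous_fderiv one_ne_zero).clm_apply continuous_const).integrable_of_hasCompactSupport
    (hc.fderiv_apply ℝ v)

lemma integral_heisX (j : Fin n) {f : Heisenberg n → ℝ} (hf : ContDiff ℝ 1 f)
    (hc : HasCompactSupport f) : ∫ q, heisX j f q = 0 := by
  have h2 : ContDiff ℝ 1 fun q : Heisenberg n => (2 * q.2.1 j) * f q :=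
    (contDiff_const.mul (contDiff_coord_snd j)).mul hf
  have c2 : HasCompactSupport fun q : Heisenberg n => (2 * q.2.1 j) * f q := hc.mul_left
  simp_rw [heisX_eq j f (hf.differentiable one_ne_zero)]
  rw [integral_add (integrable_fderiv_apply hf hc _) (integrable_fderiv_apply h2 c2 _),
    integral_fderiv_apply_eq_zero hf hc, integral_fderiv_apply_eq_zero h2 c2, add_zero]

lemma integral_heisY (j : Fin n) {f : Heisenberg n → ℝ} (hf : ContDiff ℝ 1 f)
    (hc : HasCompactSupport f) : ∫ q, heisY j f q = 0 := by
  have h2 : ContDiff ℝ 1 fun q : Heisenberg n => (-2 * q.1 j) * f q :=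
    (contDiff_const.mul (contDiff_coord_fst j)).mul hf
  have c2 : HasCompactSupport fun q : Heisenberg n => (-2 * q.1 j) * f q := hc.mul_left
  simp_rw [heisY_eq j f (hf.differentiable one_ne_zero)]
  rw [integral_add (integrable_fderiv_apply hf hc _) (integrable_fderiv_apply h2 c2 _),
    integral_fderiv_apply_eq_zero hf hc, integral_fderiv_apply_eq_zero h2 c2, add_zero]

lemma heisX_field (j : Fin n) (q : Heisenberg n) :
    heisX j (fun q => heisS q * q.1 j + q.2.2 * q.2.1 j) q =
      heisS q + 2 * (q.1 j ^ 2 + q.2.1 j ^ 2) := by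
  have hS : DifferentiableAt ℝ (heisS : Heisenberg n → ℝ) q :=
    contDiff_heisS.contDiffAt.differentiableAt one_ne_zero
  have ht : DifferentiableAt ℝ (fun q : Heisenberg n => q.2.2) q :=
    contDiff_height.contDiffAt.differentiableAt one_ne_zero
  have hx : DifferentiableAt ℝ (fun q : Heisenberg n => q.1 j) q :=
    (contDiff_coord_fst j).contDiffAt.differentiableAt one_ne_zero
  have hy : DifferentiableAt ℝ (fun q : Heisenberg n => q.2.1 j) q :=
    (contDiff_coord_snd j).contDiffAt.differentiableAt one_ne_zero
  rw [heisX_add j (hS.fun_mul hx) (ht.fun_mul hy), heisX_mul j hS hx, heisX_mul j ht hy,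
    heisX_heisS, heisX_height, heisX_coord_fst, heisX_coord_snd]
  ring

lemma heisY_field (j : Fin n) (q : Heisenberg n) :
    heisY j (fun q => heisS q * q.2.1 j - q.2.2 * q.1 j) q =
      heisS q + 2 * (q.1 j ^ 2 + q.2.1 j ^ 2) := by
  have hS : DifferentiableAt ℝ (heisS : Heisenberg n → ℝ) q :=
    contDiff_heisS.contDiffAt.differentiableAt one_ne_zero
  have ht : DifferentiableAt ℝ (fun q : Heisenberg n => q.2.2) q :=
    contDiff_height.contDiffAt.differentiableAt one_ne_zero
  have hx : DifferentiableAt ℝ (fun q : Heisenberg n => q.1 j) q :=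
    (contDiff_coord_fst j).contDiffAt.differentiableAt one_ne_zero
  have hy : DifferentiableAt ℝ (fun q : Heisenberg n => q.2.1 j) q :=
    (contDiff_coord_snd j).contDiffAt.differentiableAt one_ne_zero
  rw [heisY_sub j (hS.fun_mul hy) (ht.fun_mul hx), heisY_mul j hS hy, heisY_mul j ht hx,
    heisY_heisS, heisY_height, heisY_coord_fst, heisY_coord_snd]
  ring

lemma sum_div_field_mul {g u : Heisenberg n → ℝ} {q : Heisenberg n}
    (hg : DifferentiableAt ℝ g q) (hu : DifferentiableAt ℝ u q) :
    ∑ j : Fin n, (heisX j (fun q => (heisS q * q.1 j + q.2.2 * q.2.1 j) * (g q * u q)) q +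
      heisY j (fun q => (heisS q * q.2.1 j - q.2.2 * q.1 j) * (g q * u q)) q) =
    u q * heisW g q + g q * heisW u q + (2 * n + 4) * heisS q * (g q * u q) := by
  have hP (j : Fin n) :
      DifferentiableAt ℝ (fun q : Heisenberg n => heisS q * q.1 j + q.2.2 * q.2.1 j) q :=
    ((contDiff_heisS.mul (contDiff_coord_fst j)).add
      (contDiff_height.mul (contDiff_coord_snd j))).contDiffAt.differentiableAt one_ne_zero
  have hR (j : Fin n) :
      DifferentiableAt ℝ (fun q : Heisenberg n => heisS q * q.2.1 j - q.2.2 * q.1 j) q :=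
    ((contDiff_heisS.mul (contDiff_coord_snd j)).sub
      (contDiff_height.mul (contDiff_coord_fst j))).contDiffAt.differentiableAt one_ne_zero
  have e : (2 * n + 4) * heisS q = ∑ j : Fin n,
      (2 * heisS q + 4 * (q.1 j ^ 2 + q.2.1 j ^ 2)) := by
    rw [Finset.sum_add_distrib, ← Finset.mul_sum, ← Finset.mul_sum, sum_sq_eq_heisS]
    simp
    ring
  rw [e, heisW, heisW, Finset.mul_sum, Finset.mul_sum, Finset.sum_mul, ← Finset.sum_add_distrib,
    ← Finset.sum_add_distrib]
  refine Finset.sum_congr rfl fun j _ => ?_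
  rw [heisX_mul j (hP j) (hg.fun_mul hu), heisY_mul j (hR j) (hg.fun_mul hu), heisX_mul j hg hu,
    heisY_mul j hg hu, heisX_field, heisY_field]
  ring

lemma integral_div_field_mul {g u : Heisenberg n → ℝ} (hg : ∀ q ≠ 0, ContDiffAt ℝ 1 g q)
    (hu : ContDiff ℝ 1 u) (hc : HasCompactSupport u) (h0 : (0 : Heisenberg n) ∉ tsupport u) :
    ∫ q, (u q * heisW g q + g q * heisW u q + (2 * n + 4) * heisS q * (g q * u q)) = 0 := by
  have hgu : ContDiff ℝ 1 fun q => g q * u q := by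
    refine contDiff_iff_contDiffAt.2 fun q => ?_
    by_cases hq : q = 0
    · subst hq
      refine contDiffAt_const (c := 0) |>.congr_of_eventuallyEq ?_
      filter_upwards [notMem_tsupport_iff_eventuallyEq.1 h0] with q hq
      simp [hq]
    · exact (hg q hq).mul hu.contDiffAt
  have hguc : HasCompactSupport fun q => g q * u q := hc.mul_left
  have hP (j : Fin n) :
      ContDiff ℝ 1 (fun q => (heisS q * q.1 j + q.2.2 * q.2.1 j) * (g q * u q)) :=
    ((contDiff_heisS.mul (contDiff_coord_fst j)).add
      (contDiff_height.mul (contDiff_coord_snd j))).mul hgu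
  have hR (j : Fin n) :
      ContDiff ℝ 1 (fun q => (heisS q * q.2.1 j - q.2.2 * q.1 j) * (g q * u q)) :=
    ((contDiff_heisS.mul (contDiff_coord_snd j)).sub
      (contDiff_height.mul (contDiff_coord_fst j))).mul hgu
  have key : ∫ q, ∑ j : Fin n,
      (heisX j (fun q => (heisS q * q.1 j + q.2.2 * q.2.1 j) * (g q * u q)) q +
      heisY j (fun q => (heisS q * q.2.1 j - q.2.2 * q.1 j) * (g q * u q)) q) = 0 := by
    rw [integral_finsetSum]
    · refine Finset.sum_eq_zero fun j _ => ?_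
      rw [integral_add (integrable_heisX j (hP j) hguc.mul_left)
        (integrable_heisY j (hR j) hguc.mul_left), integral_heisX j (hP j) hguc.mul_left,
        integral_heisY j (hR j) hguc.mul_left, add_zero]
    · exact fun j _ => (integrable_heisX j (hP j) hguc.mul_left).add
        (integrable_heisY j (hR j) hguc.mul_left)
  rw [← key]
  refine integral_congr_ae ?_
  filter_upwards [ae_ne_zero_heisenberg] with q hq
  exact (sum_div_field_mul ((hg q hq).differentiableAt one_ne_zero)
    (hu.contDiffAt.differentiableAt one_ne_zero)).symm

lemma heisW_regularized {p ε : ℝ} (hε : 0 < ε) {q : Heisenberg n} (hq : q ≠ 0) :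
    heisW (fun q => (heisS q + ε) ^ ((p - 2) / 2) * heisN q ^ (-(p / 2))) q =
      (heisS q + ε) ^ ((p - 2) / 2) * heisN q ^ (-(p / 2)) *
        ((p - 2) * heisS q ^ 2 / (heisS q + ε) - 2 * p * heisS q) := by
  have hSε : 0 < heisS q + ε := add_pos_of_nonneg_of_pos (heisS_nonneg q) hε
  have hN := heisN_pos hq
  have hS : DifferentiableAt ℝ (heisS : Heisenberg n → ℝ) q :=
    contDiff_heisS.contDiffAt.differentiableAt one_ne_zero
  have hNd : DifferentiableAt ℝ (heisN : Heisenberg n → ℝ) q :=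
    contDiff_heisN.contDiffAt.differentiableAt one_ne_zero
  have d1 : HasDerivAt (fun s : ℝ => (s + ε) ^ ((p - 2) / 2))
      ((p - 2) / 2 * ((heisS q + ε) ^ ((p - 2) / 2) / (heisS q + ε))) (heisS q) := by
    have := ((hasDerivAt_id (heisS q)).add_const ε).rpow_const (p := (p - 2) / 2)
      (Or.inl hSε.ne')
    simpa [Real.rpow_sub_one hSε.ne'] using this
  have d2 : HasDerivAt (fun s : ℝ => s ^ (-(p / 2)))
      (-(p / 2) * (heisN q ^ (-(p / 2)) / heisN q)) (heisN q) := by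
    have := Real.hasDerivAt_rpow_const (p := -(p / 2)) (Or.inl hN.ne')
    rwa [Real.rpow_sub_one hN.ne'] at this
  have f1 : DifferentiableAt ℝ (fun q : Heisenberg n => (heisS q + ε) ^ ((p - 2) / 2)) q :=
    d1.differentiableAt.comp q hS
  have f2 : DifferentiableAt ℝ (fun q : Heisenberg n => heisN q ^ (-(p / 2))) q :=
    d2.differentiableAt.comp q hNd
  have e2 : ∑ j : Fin n, ((heisS q * q.1 j + q.2.2 * q.2.1 j) * q.1 j +
      (heisS q * q.2.1 j - q.2.2 * q.1 j) * q.2.1 j) = heisS q ^ 2 := by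
    rw [sq, ← congrArg (heisS q * ·) (sum_sq_eq_heisS q), Finset.mul_sum]
    exact Finset.sum_congr rfl fun j _ => by ring
  set A := (heisS q + ε) ^ ((p - 2) / 2) with hA
  set B := heisN q ^ (-(p / 2)) with hB
  have e3 : ∀ j : Fin n, (heisS q * q.1 j + q.2.2 * q.2.1 j) *
        heisX j (fun q => (heisS q + ε) ^ ((p - 2) / 2) * heisN q ^ (-(p / 2))) q +
      (heisS q * q.2.1 j - q.2.2 * q.1 j) *
        heisY j (fun q => (heisS q + ε) ^ ((p - 2) / 2) * heisN q ^ (-(p / 2))) q =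
      A * B * (p - 2) / (heisS q + ε) * ((heisS q * q.1 j + q.2.2 * q.2.1 j) * q.1 j +
      (heisS q * q.2.1 j - q.2.2 * q.1 j) * q.2.1 j) - 2 * p * (A * B) / heisN q *
      ((heisS q * q.1 j + q.2.2 * q.2.1 j) ^ 2 +
      (heisS q * q.2.1 j - q.2.2 * q.1 j) ^ 2) := by
    intro j
    rw [heisX_mul j f1 f2, heisY_mul j f1 f2, heisX_comp j d1 hS, heisX_comp j d2 hNd,
      heisY_comp j d1 hS, heisY_comp j d2 hNd, heisX_heisS, heisX_heisN, heisY_heisS, heisY_heisN]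
    ring
  rw [heisW, Finset.sum_congr rfl fun j _ => e3 j, Finset.sum_sub_distrib, ← Finset.mul_sum,
    ← Finset.mul_sum, e2, sum_field_sq]
  field_simp

end LowerBound

section Hardy

variable {n : ℕ}

lemma continuous_heisGradSq {f : Heisenberg n → ℝ} (hf : ContDiff ℝ 1 f) :
    Continuous (heisGradSq f) :=
  continuous_finsetSum _ fun j _ =>
    ((continuous_heisX j hf).pow 2).add ((continuous_heisY j hf).pow 2)

lemma continuous_heisW {f : Heisenberg n → ℝ} (hf : ContDiff ℝ 1 f) :
    Continuous (heisW f) := by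
  have hS := (contDiff_heisS (n := n) (k := 0)).continuous
  have ht := (contDiff_height (n := n) (k := 0)).continuous
  exact continuous_finsetSum _ fun j _ =>
    (((hS.mul (contDiff_coord_fst (k := 0) j).continuous).add
      (ht.mul (contDiff_coord_snd (k := 0) j).continuous)).mul (continuous_heisX j hf)).add
    (((hS.mul (contDiff_coord_snd (k := 0) j).continuous).sub
      (ht.mul (contDiff_coord_fst (k := 0) j).continuous)).mul (continuous_heisY j hf))

lemma heisGradSq_eq_zero {f : Heisenberg n → ℝ} {q : Heisenberg n} (hq : q ∉ tsupport f) :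
    heisGradSq f q = 0 := by
  simp [heisGradSq, heisX_eq_zero _ hq, heisY_eq_zero _ hq]

lemma heisW_eq_zero {f : Heisenberg n → ℝ} {q : Heisenberg n} (hq : q ∉ tsupport f) :
    heisW f q = 0 := by
  simp [heisW, heisX_eq_zero _ hq, heisY_eq_zero _ hq]

lemma integral_regularized {p ε : ℝ} (hε : 0 < ε) {u : Heisenberg n → ℝ} (hu : ContDiff ℝ 1 u)
    (hc : HasCompactSupport u) (h0 : (0 : Heisenberg n) ∉ tsupport u) :
    ∫ q, (heisS q + ε) ^ ((p - 2) / 2) * heisN q ^ (-(p / 2)) *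
      (((p - 2) * (heisS q ^ 2 / (heisS q + ε)) + (2 * n + 4 - 2 * p) * heisS q) * u q +
        heisW u q) = 0 := by
  have hg : ∀ q : Heisenberg n, q ≠ 0 → ContDiffAt ℝ 1
      (fun q => (heisS q + ε) ^ ((p - 2) / 2) * heisN q ^ (-(p / 2))) q := fun q hq =>
    ((contDiff_heisS.contDiffAt.add contDiffAt_const).rpow_const_of_ne
      (add_pos_of_nonneg_of_pos (heisS_nonneg q) hε).ne').mul
      (contDiff_heisN.contDiffAt.rpow_const_of_ne (heisN_pos hq).ne')
  rw [← integral_div_field_mul hg hu hc h0]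
  refine integral_congr_ae ?_
  filter_upwards [ae_ne_zero_heisenberg] with q hq
  rw [heisW_regularized hε hq]
  ring

lemma add_rpow_mul_sq_le {s ε a b : ℝ} (hs : 0 ≤ s) (hε : 0 < ε) (hε1 : ε ≤ 1)
    (hb : 0 ≤ b) (hab : 0 ≤ a + b) : (s + ε) ^ a * s ^ b ≤ (s + 1) ^ (a + b) := by
  have h : 0 < s + ε := by positivity
  calc (s + ε) ^ a * s ^ b ≤ (s + ε) ^ a * (s + ε) ^ b := by gcongr; linarith
    _ = (s + ε) ^ (a + b) := (Real.rpow_add h _ _).symm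
    _ ≤ (s + 1) ^ (a + b) := by gcongr

lemma integral_field_limit {p : ℝ} (hp : 1 < p) {u : Heisenberg n → ℝ} (hu : ContDiff ℝ 1 u)
    (hc : HasCompactSupport u) (h0 : (0 : Heisenberg n) ∉ tsupport u) :
    Integrable (fun q => heisS q ^ ((p - 2) / 2) * heisN q ^ (-(p / 2)) *
      ((2 * n + 2 - p) * heisS q * u q + heisW u q)) ∧
    ∫ q, heisS q ^ ((p - 2) / 2) * heisN q ^ (-(p / 2)) *
      ((2 * n + 2 - p) * heisS q * u q + heisW u q) = 0 := by
  have cS := (contDiff_heisS (n := n) (k := 0)).continuous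
  have cN := (contDiff_heisN (n := n) (k := 0)).continuous
  have hne : ∀ q ∈ tsupport u, q ≠ 0 := by
    rintro q hq rfl
    exact h0 hq
  set c : ℝ := |p - 2| + |2 * n + 4 - 2 * p| with hcdef
  set F : ℕ → Heisenberg n → ℝ := fun k q =>
    (heisS q + 1 / ((k : ℝ) + 1)) ^ ((p - 2) / 2) * heisN q ^ (-(p / 2)) *
      (((p - 2) * (heisS q ^ 2 / (heisS q + 1 / ((k : ℝ) + 1))) +
        (2 * n + 4 - 2 * p) * heisS q) * u q + heisW u q) with hF
  set F₀ : Heisenberg n → ℝ := fun q => heisS q ^ ((p - 2) / 2) * heisN q ^ (-(p / 2)) *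
      ((2 * n + 2 - p) * heisS q * u q + heisW u q) with hF₀
  set G : Heisenberg n → ℝ := fun q =>
    heisN q ^ (-(p / 2)) * ((heisS q + 1) ^ (p / 2) * (c * |u q|) +
      (heisS q + 1) ^ ((p - 1) / 2) * (√(heisN q) * √(heisGradSq u q))) with hG
  have hεp (k : ℕ) : 0 < 1 / ((k : ℝ) + 1) := by positivity
  have hε1 (k : ℕ) : 1 / ((k : ℝ) + 1) ≤ 1 := by
    rw [div_le_one (by positivity)]
    have := k.cast_nonneg (α := ℝ)
    linarith
  have hSp (k : ℕ) (q : Heisenberg n) : 0 < heisS q + 1 / ((k : ℝ) + 1) :=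
    add_pos_of_nonneg_of_pos (heisS_nonneg q) (hεp k)
  have cNr : ContinuousOn (fun q : Heisenberg n => heisN q ^ (-(p / 2))) (tsupport u) :=
    cN.continuousOn.rpow_const fun q hq => Or.inl (heisN_pos (hne q hq)).ne'
  have hFi (k : ℕ) : Integrable (F k) := by
    refine integrable_of_continuousOn_support_subset hc ?_ fun q hq => ?_
    · refine ContinuousOn.mul (ContinuousOn.mul ?_ cNr) (Continuous.continuousOn ?_)
      · exact (cS.add continuous_const).continuousOn.rpow_const fun q _ => Or.inl (hSp k q).ne'
      · refine Continuous.add (Continuous.mul ?_ hu.continuous) (continuous_heisW hu)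
        exact (continuous_const.mul ((cS.pow 2).div (cS.add continuous_const)
          fun q => (hSp k q).ne')).add (continuous_const.mul cS)
    · simp [hF, image_eq_zero_of_notMem_tsupport hq, heisW_eq_zero hq]
  have hGi : Integrable G := by
    have hS1 (q : Heisenberg n) : heisS q + 1 ≠ 0 := by
      have := heisS_nonneg q
      positivity
    refine integrable_of_continuousOn_support_subset hc ?_ fun q hq => ?_
    · refine cNr.mul (Continuous.continuousOn ?_)
      exact (((cS.add continuous_const).rpow_const fun q => Or.inl (hS1 q)).mul
        (continuous_const.mul hu.continuous.abs)).add
        (((cS.add continuous_const).rpow_const fun q => Or.inl (hS1 q)).mul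
        (cN.sqrt.mul (continuous_heisGradSq hu).sqrt))
    · simp [hG, image_eq_zero_of_notMem_tsupport hq, heisGradSq_eq_zero hq]
  have hbound (k : ℕ) (q : Heisenberg n) : ‖F k q‖ ≤ G q := by
    have hS := heisS_nonneg q
    have hNp : 0 ≤ heisN q ^ (-(p / 2)) := Real.rpow_nonneg (heisN_nonneg q) _
    set ε := 1 / ((k : ℝ) + 1) with hε
    have hAp : 0 ≤ (heisS q + ε) ^ ((p - 2) / 2) := Real.rpow_nonneg (hSp k q).le _
    have h1 : (heisS q + ε) ^ ((p - 2) / 2) * heisS q ≤ (heisS q + 1) ^ (p / 2) := by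
      have := add_rpow_mul_sq_le (a := (p - 2) / 2) (b := 1) hS (hεp k) (hε1 k) zero_le_one
        (by linarith)
      rwa [Real.rpow_one, show (p - 2) / 2 + 1 = p / 2 by ring] at this
    have h2 : (heisS q + ε) ^ ((p - 2) / 2) * √(heisS q) ≤ (heisS q + 1) ^ ((p - 1) / 2) := by
      have := add_rpow_mul_sq_le (a := (p - 2) / 2) (b := 1 / 2) hS (hεp k) (hε1 k) (by norm_num)
        (by linarith)
      rwa [← Real.sqrt_eq_rpow, show (p - 2) / 2 + 1 / 2 = (p - 1) / 2 by ring] at this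
    have h3 : heisS q ^ 2 / (heisS q + ε) ≤ heisS q := by
      rw [div_le_iff₀ (hSp k q)]
      nlinarith [mul_nonneg hS (hεp k).le]
    have h3' : 0 ≤ heisS q ^ 2 / (heisS q + ε) := div_nonneg (sq_nonneg _) (hSp k q).le
    have h4 : |(p - 2) * (heisS q ^ 2 / (heisS q + ε)) + (2 * n + 4 - 2 * p) * heisS q|
        ≤ c * heisS q := by
      refine (abs_add_le _ _).trans ?_
      rw [abs_mul, abs_mul, abs_of_nonneg h3', abs_of_nonneg hS, hcdef, add_mul]
      gcongr
    have h5 := abs_heisW_le u q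
    have hc0 : 0 ≤ c := by positivity
    calc ‖F k q‖ = (heisS q + ε) ^ ((p - 2) / 2) * heisN q ^ (-(p / 2)) *
          |((p - 2) * (heisS q ^ 2 / (heisS q + ε)) + (2 * n + 4 - 2 * p) * heisS q) * u q +
            heisW u q| := by
          rw [hF, Real.norm_eq_abs, abs_mul, abs_of_nonneg (mul_nonneg hAp hNp)]
      _ ≤ (heisS q + ε) ^ ((p - 2) / 2) * heisN q ^ (-(p / 2)) *
          (c * heisS q * |u q| + √(heisS q) * √(heisN q) * √(heisGradSq u q)) := by
          refine mul_le_mul_of_nonneg_left ?_ (mul_nonneg hAp hNp)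
          refine (abs_add_le _ _).trans (add_le_add ?_ h5)
          rw [abs_mul]
          gcongr
      _ = heisN q ^ (-(p / 2)) * (((heisS q + ε) ^ ((p - 2) / 2) * heisS q) * (c * |u q|) +
          ((heisS q + ε) ^ ((p - 2) / 2) * √(heisS q)) *
            (√(heisN q) * √(heisGradSq u q))) := by ring
      _ ≤ G q := by
          simp only [hG]
          gcongr
  have hlim : ∀ q, Tendsto (fun k => F k q) atTop (𝓝 (F₀ q)) := by
    intro q
    rcases (heisS_nonneg q).eq_or_lt with hS | hS
    · have hW : heisW u q = 0 := by
        have := abs_heisW_le u q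
        rw [← hS] at this
        simpa using this
      have e1 : F₀ q = 0 := by simp [hF₀, ← hS, hW]
      have e2 (k : ℕ) : F k q = 0 := by simp [hF, ← hS, hW]
      simp [e1, e2]
    · have hε : Tendsto (fun k : ℕ => heisS q + 1 / ((k : ℝ) + 1)) atTop (𝓝 (heisS q)) := by
        simpa using tendsto_const_nhds.add (tendsto_one_div_add_atTop_nhds_zero_nat (𝕜 := ℝ))
      have e : F₀ q = heisS q ^ ((p - 2) / 2) * heisN q ^ (-(p / 2)) *
          (((p - 2) * (heisS q ^ 2 / heisS q) + (2 * n + 4 - 2 * p) * heisS q) * u q +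
            heisW u q) := by
        simp only [hF₀]
        field_simp
        ring
      rw [e]
      exact ((hε.rpow_const (Or.inl hS.ne')).mul tendsto_const_nhds).mul
        ((((tendsto_const_nhds.mul (tendsto_const_nhds.div hε hS.ne')).add
          tendsto_const_nhds).mul tendsto_const_nhds).add tendsto_const_nhds)
  have hF₀b (q : Heisenberg n) : ‖F₀ q‖ ≤ G q :=
    le_of_tendsto (hlim q).norm (Eventually.of_forall fun k => hbound k q)
  refine ⟨hGi.mono' (aestronglyMeasurable_of_tendsto_ae atTop
    (fun k => (hFi k).aestronglyMeasurable) (Eventually.of_forall hlim))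
    (Eventually.of_forall hF₀b), ?_⟩
  have hT := tendsto_integral_of_dominated_convergence G
    (fun k => (hFi k).aestronglyMeasurable) hGi
    (fun k => Eventually.of_forall (hbound k)) (Eventually.of_forall hlim)
  have hz (k : ℕ) : ∫ q, F k q = 0 := integral_regularized (hεp k) hu hc h0
  simp only [hz] at hT
  exact (tendsto_nhds_unique hT tendsto_const_nhds)

lemma mul_rpow_sub_one_mul_le {a b C p : ℝ} (ha : 0 ≤ a) (hb : 0 ≤ b) (hC : 0 < C) (hp : 1 < p) :
    p * b ^ (p - 1) * a ≤ C ^ (1 - p) * a ^ p + (p - 1) * C * b ^ p := by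
  rcases hb.eq_or_lt with rfl | hb
  · rw [Real.zero_rpow (by linarith), Real.zero_rpow (by linarith)]
    simp only [mul_zero, zero_mul, add_zero]
    positivity
  have h := one_add_mul_self_le_rpow_one_add (s := a / (C * b) - 1) (p := p)
    (by have : 0 ≤ a / (C * b) := by positivity
        linarith) hp.le
  rw [add_sub_cancel, Real.div_rpow ha (by positivity), Real.mul_rpow hC.le hb.le] at h
  have h2 := mul_le_mul_of_nonneg_left h (show 0 ≤ C * b ^ p by positivity)
  have e1 : C * b ^ p * (1 + p * (a / (C * b) - 1)) =
      p * b ^ (p - 1) * a - (p - 1) * C * b ^ p := by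
    rw [Real.rpow_sub_one hb.ne']
    field_simp
    ring
  have e2 : C * b ^ p * (a ^ p / (C ^ p * b ^ p)) = C ^ (1 - p) * a ^ p := by
    rw [Real.rpow_sub hC, Real.rpow_one]
    field_simp
  linarith

lemma heisW_abs_rpow {p : ℝ} (hp : 1 < p) {φ : Heisenberg n → ℝ} {q : Heisenberg n}
    (hφ : DifferentiableAt ℝ φ q) :
    heisW (fun q => |φ q| ^ p) q = p * |φ q| ^ (p - 2) * φ q * heisW φ q := by
  rw [heisW, heisW, Finset.mul_sum]
  refine Finset.sum_congr rfl fun j _ => ?_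
  rw [heisX_comp j (hasDerivAt_abs_rpow (φ q) hp) hφ,
    heisY_comp j (hasDerivAt_abs_rpow (φ q) hp) hφ]
  ring

lemma abs_rpow_sub_two_mul {p x : ℝ} (hp : 1 < p) : |(|x| ^ (p - 2) * x)| = |x| ^ (p - 1) := by
  rcases eq_or_ne x 0 with rfl | hx
  · simp [Real.zero_rpow (by linarith : p - 1 ≠ 0)]
  · rw [abs_mul, abs_of_nonneg (by positivity), ← Real.rpow_add_one (abs_pos.2 hx).ne']
    ring_nf

/-- The `L^p` Hardy inequality on the Heisenberg group, with the sharp constant. -/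
theorem heisenberg_hardy_inequality {p : ℝ} (hp : 1 < p) (hpQ : p < 2 * n + 2)
    {φ : Heisenberg n → ℝ} (hφ : ContDiff ℝ 1 φ) (hc : HasCompactSupport φ)
    (h0 : (0 : Heisenberg n) ∉ tsupport φ) :
    ((2 * n + 2 - p) / p) ^ p * ∫ q, √(heisS q) ^ p / heisN q ^ (p / 2) * |φ q| ^ p ≤
      ∫ q, √(heisGradSq φ q) ^ p := by
  have cS := (contDiff_heisS (n := n) (k := 0)).continuous
  have cN := (contDiff_heisN (n := n) (k := 0)).continuous
  have hp0 : 0 < p := by linarith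
  set C := (2 * n + 2 - p) / p with hCdef
  have hC : 0 < C := div_pos (by linarith) hp0
  have hpC : (2 * n + 2 - p : ℝ) = p * C := by rw [hCdef]; field_simp
  set u : Heisenberg n → ℝ := fun q => |φ q| ^ p with hudef
  have hu : ContDiff ℝ 1 u := by
    have := (contDiff_norm_rpow (E := ℝ) hp).comp hφ
    simpa [Function.comp_def] using this
  have hsub : tsupport u ⊆ tsupport φ := closure_mono fun q hq => by
    simp only [hudef, Function.mem_support] at hq ⊢
    rintro h
    simp [h, hp0.ne'] at hq
  have huc : HasCompactSupport u := hc.mono' ((subset_tsupport u).trans hsub)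
  have hne : ∀ q ∈ tsupport φ, q ≠ 0 := by
    rintro q hq rfl
    exact h0 hq
  obtain ⟨hFi, hF0⟩ := integral_field_limit hp hu huc fun h => h0 (hsub h)
  have hai : Integrable fun q => √(heisGradSq φ q) ^ p := by
    refine integrable_of_continuousOn_support_subset hc (Continuous.continuousOn ?_)
      fun q hq => ?_
    · exact (continuous_heisGradSq hφ).sqrt.rpow_const fun _ => Or.inr hp0.le
    · simp [heisGradSq_eq_zero hq, hp0.ne']
  have hbi : Integrable fun q => √(heisS q) ^ p / heisN q ^ (p / 2) * |φ q| ^ p := by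
    refine integrable_of_continuousOn_support_subset hc ?_ fun q hq => ?_
    · refine ContinuousOn.mul (ContinuousOn.div ?_ ?_ fun q hq => ?_) hu.continuous.continuousOn
      · exact (cS.sqrt.rpow_const fun _ => Or.inr hp0.le).continuousOn
      · exact cN.continuousOn.rpow_const fun q hq => Or.inl (heisN_pos (hne q hq)).ne'
      · exact (Real.rpow_pos_of_pos (heisN_pos (hne q hq)) _).ne'
    · simp [image_eq_zero_of_notMem_tsupport hq, hp0.ne']
  have hmono : ∫ q, (C * (√(heisS q) ^ p / heisN q ^ (p / 2) * |φ q| ^ p) -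
      C ^ (1 - p) * √(heisGradSq φ q) ^ p) ≤ 0 := by
    rw [← hF0]
    refine integral_mono_ae ((hbi.const_mul C).sub (hai.const_mul _)) hFi ?_
    filter_upwards [ae_ne_zero_heisenberg] with q hq
    have hN := heisN_pos hq
    rcases (heisS_nonneg q).eq_or_lt with hS | hS
    · have hW : heisW u q = 0 := by
        have := abs_heisW_le u q
        rw [← hS] at this
        simpa using this
      simp only [← hS, hW, Real.sqrt_zero, Real.zero_rpow hp0.ne']
      simp only [zero_div, zero_mul, mul_zero, zero_sub, add_zero, neg_nonpos]
      positivity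
    set s := √(heisS q) with hs
    set m := √(heisN q) with hm
    have hsp : 0 < s := Real.sqrt_pos.2 hS
    have hmp : 0 < m := Real.sqrt_pos.2 hN
    have eS : heisS q = s ^ (2 : ℝ) := by rw [hs]; norm_num [Real.sq_sqrt hS.le]
    have eN : heisN q = m ^ (2 : ℝ) := by rw [hm]; norm_num [Real.sq_sqrt hN.le]
    have eSr (r : ℝ) : heisS q ^ (r / 2) = s ^ r := by
      rw [eS, ← Real.rpow_mul hsp.le]; ring_nf
    have eNr : heisN q ^ (p / 2) = m ^ p := by
      rw [eN, ← Real.rpow_mul hmp.le]; ring_nf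
    set a := √(heisGradSq φ q) with ha
    have ha0 : 0 ≤ a := Real.sqrt_nonneg _
    have hW : |heisW u q| ≤ p * |φ q| ^ (p - 1) * (s * m * a) := by
      rw [heisW_abs_rpow hp (hφ.contDiffAt.differentiableAt one_ne_zero), mul_assoc p, abs_mul,
        abs_mul, abs_rpow_sub_two_mul hp, abs_of_pos hp0]
      gcongr
      exact abs_heisW_le φ q
    have hY := mul_rpow_sub_one_mul_le (b := s / m * |φ q|) ha0 (by positivity) hC hp
    rw [Real.mul_rpow (by positivity) (abs_nonneg _), Real.mul_rpow (by positivity) (abs_nonneg _),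
      Real.div_rpow hsp.le hmp.le, Real.div_rpow hsp.le hmp.le] at hY
    rw [Real.rpow_neg hN.le, eSr, eNr, hpC, show heisS q = s ^ 2 from (Real.sq_sqrt hS.le).symm]
    have h1 : s ^ (p - 2) * (m ^ p)⁻¹ * (-(p * |φ q| ^ (p - 1) * (s * m * a))) ≤
        s ^ (p - 2) * (m ^ p)⁻¹ * heisW u q :=
      mul_le_mul_of_nonneg_left (neg_le_of_abs_le hW) (by positivity)
    have e1 : s ^ (p - 2) * (m ^ p)⁻¹ * (-(p * |φ q| ^ (p - 1) * (s * m * a))) =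
        -(p * (s ^ (p - 1) / m ^ (p - 1) * |φ q| ^ (p - 1)) * a) := by
      rw [show p - 2 = p - 1 - 1 by ring, Real.rpow_sub_one hsp.ne' (p - 1),
        Real.rpow_sub_one hmp.ne' p]
      field_simp
    have e2 : s ^ (p - 2) * (m ^ p)⁻¹ * (p * C * s ^ 2 * u q) =
        p * C * (s ^ p / m ^ p * |φ q| ^ p) := by
      rw [Real.rpow_sub hsp, Real.rpow_two]
      field_simp
      rfl
    rw [mul_add, e2]
    linarith
  rw [integral_sub (hbi.const_mul C) (hai.const_mul _), integral_const_mul, integral_const_mul,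
    sub_nonpos] at hmono
  have := mul_le_mul_of_nonneg_left hmono (Real.rpow_nonneg hC.le (p - 1))
  rw [← mul_assoc, ← mul_assoc, ← Real.rpow_add hC, ← Real.rpow_add_one hC.ne'] at this
  simpa using this

end Hardy

section Dilation

variable {n : ℕ}

/-- The anisotropic dilation `(z, t) ↦ (r z, r² t)`. -/
noncomputable def heisDil (r : ℝ) (q : Heisenberg n) : Heisenberg n :=
  (r • q.1, r • q.2.1, r ^ 2 • q.2.2)

lemma heisS_heisDil (r : ℝ) (q : Heisenberg n) : heisS (heisDil r q) = r ^ 2 * heisS q := by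
  simp only [heisS, heisDil, norm_smul, mul_pow, Real.norm_eq_abs, sq_abs]
  ring

lemma heisN_heisDil (r : ℝ) (q : Heisenberg n) : heisN (heisDil r q) = r ^ 4 * heisN q := by
  simp only [heisN, heisS_heisDil]
  simp only [heisDil, smul_eq_mul]
  ring

lemma measurable_heisDil (r : ℝ) : Measurable (heisDil r : Heisenberg n → Heisenberg n) := by
  unfold heisDil
  fun_prop

lemma map_heisDil_volume {r : ℝ} (hr : 0 < r) :
    Measure.map (heisDil r) (volume : Measure (Heisenberg n)) =
      ENNReal.ofReal ((r ^ (2 * n + 2))⁻¹) • volume := by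
  have e : (heisDil r : Heisenberg n → Heisenberg n) =
      Prod.map (r • ·) (Prod.map (r • ·) (r ^ 2 • ·)) := rfl
  have hv : (volume : Measure (Heisenberg n)) = (volume : Measure (EuclideanSpace ℝ (Fin n))).prod
      ((volume : Measure (EuclideanSpace ℝ (Fin n))).prod (volume : Measure ℝ)) := rfl
  rw [e, hv, ← Measure.map_prod_map _ _ (by fun_prop) (by fun_prop),
    ← Measure.map_prod_map _ _ (by fun_prop) (by fun_prop),
    Measure.map_addHaar_smul _ hr.ne', Measure.map_addHaar_smul _ (pow_pos hr 2).ne']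
  simp only [Measure.prod_smul_left, Measure.prod_smul_right, smul_smul, finrank_euclideanSpace,
    Fintype.card_fin, Module.finrank_self, pow_one]
  rw [← ENNReal.ofReal_mul (abs_nonneg _), ← ENNReal.ofReal_mul (by positivity)]
  congr 2
  rw [abs_of_pos (by positivity), abs_of_pos (by positivity)]
  field_simp
  ring

lemma measurable_heisS : Measurable (heisS : Heisenberg n → ℝ) :=
  (contDiff_heisS (k := 0)).continuous.measurable

lemma measurable_heisN : Measurable (heisN : Heisenberg n → ℝ) :=
  (contDiff_heisN (k := 0)).continuous.measurable

/-- The density `|z|^p (|z|⁴ + t²)^{-(Q+p)/4}`, homogeneous of degree `-Q`. -/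
noncomputable def heisDensity (p : ℝ) (q : Heisenberg n) : ℝ :=
  √(heisS q) ^ p / heisN q ^ (p / 2) * heisN q ^ (-((2 * n + 2 - p) / 4))

lemma measurable_heisDensity (p : ℝ) : Measurable (heisDensity p : Heisenberg n → ℝ) := by
  have h1 := measurable_heisS (n := n)
  have h2 := measurable_heisN (n := n)
  unfold heisDensity
  fun_prop

lemma heisDensity_nonneg (p : ℝ) (q : Heisenberg n) : 0 ≤ heisDensity p q := by
  have := heisN_nonneg q
  unfold heisDensity
  positivity

lemma heisDensity_heisDil {p r : ℝ} (hr : 0 < r) (q : Heisenberg n) :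
    heisDensity p (heisDil r q) = (r ^ (2 * n + 2))⁻¹ * heisDensity p q := by
  have hN := heisN_nonneg q
  unfold heisDensity
  rw [heisS_heisDil, heisN_heisDil, Real.sqrt_mul (by positivity), Real.sqrt_sq hr.le,
    Real.mul_rpow hr.le (Real.sqrt_nonneg _), Real.mul_rpow (by positivity) hN,
    Real.mul_rpow (by positivity) hN, ← Real.rpow_natCast_mul hr.le,
    ← Real.rpow_natCast_mul hr.le]
  have e : (r ^ (2 * n + 2))⁻¹ = r ^ p / r ^ (((4 : ℕ) : ℝ) * (p / 2)) *
      r ^ (((4 : ℕ) : ℝ) * -((2 * n + 2 - p) / 4)) := by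
    rw [← Real.rpow_natCast, ← Real.rpow_neg hr.le, ← Real.rpow_sub hr, ← Real.rpow_add hr]
    congr 1
    push_cast
    ring
  rw [e]
  ring

lemma isCompact_heisN_preimage_Icc (a b : ℝ) :
    IsCompact {q : Heisenberg n | heisN q ∈ Set.Icc a b} := by
  refine Metric.isCompact_of_isClosed_isBounded
    (isClosed_Icc.preimage (contDiff_heisN (k := 0)).continuous) ?_
  refine (Metric.isBounded_closedBall (x := (0 : Heisenberg n)) (r := 1 + b)).subset ?_
  rintro q ⟨-, hq⟩
  have hS := heisS_nonneg q
  have hSN := heisS_sq_le_heisN q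
  have ht : q.2.2 ^ 2 ≤ heisN q := by unfold heisN; nlinarith [sq_nonneg (heisS q)]
  have hx : ‖q.1‖ ^ 2 ≤ heisS q := by unfold heisS; nlinarith [sq_nonneg ‖q.2.1‖]
  have hy : ‖q.2.1‖ ^ 2 ≤ heisS q := by unfold heisS; nlinarith [sq_nonneg ‖q.1‖]
  have hb : 0 ≤ b := (heisN_nonneg q).trans hq
  rw [mem_closedBall_zero_iff, Prod.norm_def, Prod.norm_def]
  refine max_le ?_ (max_le ?_ ?_)
  · nlinarith [norm_nonneg q.1, sq_nonneg (heisS q - 1)]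
  · nlinarith [norm_nonneg q.2.1, sq_nonneg (heisS q - 1)]
  · rw [Real.norm_eq_abs]
    exact abs_le.2 ⟨by nlinarith, by nlinarith⟩

/-- The pushforward of the homogeneous density of degree `-Q` under `log (|z|⁴ + t²)`. -/
noncomputable def heisLogMeasure (n : ℕ) (p : ℝ) : Measure ℝ :=
  ((volume : Measure (Heisenberg n)).withDensity
    fun q => ENNReal.ofReal (heisDensity p q)).map fun q => Real.log (heisN q)

lemma measurable_log_heisN : Measurable fun q : Heisenberg n => Real.log (heisN q) :=
  Real.measurable_log.comp measurable_heisN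

lemma lintegral_heisLogMeasure (p : ℝ) {f : ℝ → ENNReal} (hf : Measurable f) :
    ∫⁻ s, f s ∂heisLogMeasure n p =
      ∫⁻ q : Heisenberg n, ENNReal.ofReal (heisDensity p q) * f (Real.log (heisN q)) := by
  rw [heisLogMeasure, lintegral_map hf measurable_log_heisN]
  exact lintegral_withDensity_eq_lintegral_mul _ (measurable_heisDensity p).ennreal_ofReal
    (g := fun q => f (Real.log (heisN q))) (hf.comp measurable_log_heisN)

instance isAddLeftInvariant_heisLogMeasure (p : ℝ) :
    (heisLogMeasure n p).IsAddLeftInvariant := by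
  refine ⟨fun τ => Measure.ext_of_lintegral _ fun f hf => ?_⟩
  rw [lintegral_map hf (measurable_const_add τ),
    lintegral_heisLogMeasure p (f := fun s => f (τ + s)) (hf.comp (measurable_const_add τ)),
    lintegral_heisLogMeasure p hf]
  set r := Real.exp (τ / 4) with hrdef
  have hr : 0 < r := Real.exp_pos _
  set c := ENNReal.ofReal ((r ^ (2 * n + 2))⁻¹) with hc
  have hc0 : c ≠ 0 := by
    rw [hc, ne_eq, ENNReal.ofReal_eq_zero, not_le]
    positivity
  have key : c * ∫⁻ q : Heisenberg n, ENNReal.ofReal (heisDensity p q) *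
        f (τ + Real.log (heisN q)) =
      c * ∫⁻ q : Heisenberg n, ENNReal.ofReal (heisDensity p q) * f (Real.log (heisN q)) := by
    have hm : Measurable fun q : Heisenberg n =>
        ENNReal.ofReal (heisDensity p q) * f (Real.log (heisN q)) :=
      (measurable_heisDensity p).ennreal_ofReal.mul (hf.comp measurable_log_heisN)
    rw [← smul_eq_mul c, ← smul_eq_mul c, ← lintegral_smul_measure, ← lintegral_smul_measure,
      ← map_heisDil_volume hr, lintegral_map hm (measurable_heisDil r), map_heisDil_volume hr,
      lintegral_smul_measure, smul_eq_mul, ← lintegral_const_mul' _ _ ENNReal.ofReal_ne_top]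
    refine lintegral_congr_ae ?_
    filter_upwards [ae_ne_zero_heisenberg] with q hq
    rw [heisDensity_heisDil hr, heisN_heisDil, ENNReal.ofReal_mul (by positivity),
      Real.log_mul (by positivity) (heisN_pos hq).ne', Real.log_pow, hrdef, Real.log_exp, mul_assoc]
    congr 4
    push_cast
    ring
  exact (ENNReal.mul_right_inj hc0 ENNReal.ofReal_ne_top).1 key

lemma isFiniteMeasureOnCompacts_heisLogMeasure {p : ℝ} (hp : 0 < p) :
    IsFiniteMeasureOnCompacts (heisLogMeasure n p) := by
  refine ⟨fun K hK => ?_⟩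
  obtain ⟨M, hM⟩ := hK.isBounded.subset_closedBall 0
  set A : Set (Heisenberg n) := {q | heisN q ∈ Set.Icc (Real.exp (-M)) (Real.exp M)} with hA
  have hAc : IsCompact A := isCompact_heisN_preimage_Icc _ _
  have hint : IntegrableOn (heisDensity p : Heisenberg n → ℝ) A := by
    refine ContinuousOn.integrableOn_compact hAc ?_
    have hne : ∀ q ∈ A, 0 < heisN q := fun q hq => (Real.exp_pos _).trans_le hq.1
    have cN := (contDiff_heisN (n := n) (k := 0)).continuous.continuousOn (s := A)
    refine ContinuousOn.mul (ContinuousOn.div ?_ ?_ fun q hq => ?_) ?_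
    · exact ((contDiff_heisS (k := 0)).continuous.sqrt.rpow_const
        fun _ => Or.inr hp.le).continuousOn
    · exact cN.rpow_const fun q hq => Or.inl (hne q hq).ne'
    · exact (Real.rpow_pos_of_pos (hne q hq) _).ne'
    · exact cN.rpow_const fun q hq => Or.inl (hne q hq).ne'
  calc heisLogMeasure n p K ≤ heisLogMeasure n p (Metric.closedBall 0 M) := measure_mono hM
    _ = ∫⁻ s, (Metric.closedBall (0 : ℝ) M).indicator 1 s ∂heisLogMeasure n p := by
        rw [lintegral_indicator_one Metric.isClosed_closedBall.measurableSet]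
    _ = ∫⁻ q : Heisenberg n, ENNReal.ofReal (heisDensity p q) *
          (Metric.closedBall (0 : ℝ) M).indicator 1 (Real.log (heisN q)) :=
        lintegral_heisLogMeasure p
          (measurable_one.indicator Metric.isClosed_closedBall.measurableSet)
    _ = ∫⁻ q in A, ENNReal.ofReal (heisDensity p q) := by
        rw [← lintegral_indicator hAc.measurableSet]
        refine lintegral_congr_ae ?_
        filter_upwards [ae_ne_zero_heisenberg] with q hq
        have hN := heisN_pos hq
        have : Real.log (heisN q) ∈ Metric.closedBall (0 : ℝ) M ↔ q ∈ A := by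
          rw [mem_closedBall_zero_iff, Real.norm_eq_abs, abs_le, hA, Set.mem_ofPred_eq, Set.mem_Icc,
            Real.le_log_iff_exp_le hN, Real.log_le_iff_le_exp hN]
        by_cases hqA : q ∈ A
        · simp [hqA, this.2 hqA]
        · simp [hqA, mt this.1 hqA]
    _ < ⊤ := hint.lintegral_lt_top

lemma heisLogMeasure_ne_zero (hn : 1 ≤ n) (p : ℝ) : heisLogMeasure n p ≠ 0 := by
  intro h
  have h1 : ∫⁻ q : Heisenberg n, ENNReal.ofReal (heisDensity p q) = 0 := by
    have := lintegral_heisLogMeasure (n := n) p (f := 1) measurable_one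
    simpa [h] using this.symm
  rw [lintegral_eq_zero_iff (measurable_heisDensity p).ennreal_ofReal] at h1
  have hU : IsOpen {q : Heisenberg n | 0 < heisS q} :=
    isOpen_lt continuous_const (contDiff_heisS (k := 0)).continuous
  have hne : {q : Heisenberg n | 0 < heisS q}.Nonempty :=
    ⟨(EuclideanSpace.single ⟨0, hn⟩ 1, 0, 0), by simp [heisS]⟩
  refine (hU.measure_pos volume hne).ne' (measure_mono_null (fun q hq => ?_) h1)
  simp only [Set.mem_ofPred_eq] at hq
  have hN : 0 < heisN q := lt_of_lt_of_le (by positivity) (heisS_sq_le_heisN q)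
  have hD : 0 < heisDensity p q := by
    have := Real.sqrt_pos.2 hq
    unfold heisDensity
    positivity
  simpa using hD

/-- Polar coordinates: integrating a function of `log (|z|⁴ + t²)` against the homogeneous
density of degree `-Q` is a multiple of integration on the line. -/
lemma exists_integral_heisDensity_mul (hn : 1 ≤ n) {p : ℝ} (hp : 0 < p) :
    ∃ c : ℝ, 0 < c ∧ ∀ F : ℝ → ℝ, Continuous F →
      ∫ q : Heisenberg n, heisDensity p q * F (Real.log (heisN q)) = c * ∫ s, F s := by
  have := isFiniteMeasureOnCompacts_heisLogMeasure (n := n) hp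
  have hμ := Measure.isAddLeftInvariant_eq_smul (heisLogMeasure n p) (volume : Measure ℝ)
  set c := Measure.addHaarScalarFactor (heisLogMeasure n p) (volume : Measure ℝ) with hc
  refine ⟨c, ?_, fun F hF => ?_⟩
  · refine lt_of_le_of_ne c.2 fun h => heisLogMeasure_ne_zero hn p ?_
    have h0 : c = 0 := NNReal.coe_eq_zero.1 h.symm
    rw [hμ, h0, zero_smul]
  · have h1 : ∫ s, F s ∂heisLogMeasure n p = c * ∫ s, F s := by
      rw [hμ, integral_smul_nnreal_measure]
      rfl
    rw [← h1, heisLogMeasure, integral_map measurable_log_heisN.aemeasurable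
      hF.aestronglyMeasurable, integral_withDensity_eq_integral_toReal_smul
      (measurable_heisDensity p).ennreal_ofReal (by simp)]
    simp only [ENNReal.toReal_ofReal (heisDensity_nonneg p _), smul_eq_mul]

end Dilation

section TestFunctions

variable {n : ℕ}

/-- The test function `N^{-a} g(log N)` with `N = |z|⁴ + t²`. -/
noncomputable def heisTest (a : ℝ) (g : ℝ → ℝ) (q : Heisenberg n) : ℝ :=
  heisN q ^ (-a) * g (Real.log (heisN q))

lemma hasDerivAt_rpow_mul_comp_log {a r : ℝ} (hr : 0 < r) {g : ℝ → ℝ}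
    (hg : DifferentiableAt ℝ g (Real.log r)) :
    HasDerivAt (fun r => r ^ (-a) * g (Real.log r))
      (r ^ (-a) / r * (deriv g (Real.log r) - a * g (Real.log r))) r := by
  have h1 := Real.hasDerivAt_rpow_const (x := r) (p := -a) (Or.inl hr.ne')
  have h2 := hg.hasDerivAt.comp r (Real.hasDerivAt_log hr.ne')
  refine (h1.mul h2).congr_deriv ?_
  rw [Real.rpow_sub_one hr.ne']
  simp only [Function.comp_apply]
  field_simp
  ring

lemma heisGradSq_heisTest (a : ℝ) {g : ℝ → ℝ} (hg : Differentiable ℝ g) {q : Heisenberg n}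
    (hq : q ≠ 0) :
    heisGradSq (heisTest a g) q = (heisN q ^ (-a) / heisN q *
      (4 * (deriv g (Real.log (heisN q)) - a * g (Real.log (heisN q))))) ^ 2 *
        (heisS q * heisN q) := by
  have hN : DifferentiableAt ℝ (heisN : Heisenberg n → ℝ) q :=
    contDiff_heisN.contDiffAt.differentiableAt one_ne_zero
  have hh := hasDerivAt_rpow_mul_comp_log (a := a) (heisN_pos hq) (hg (Real.log (heisN q)))
  rw [← sum_field_sq, Finset.mul_sum]
  refine Finset.sum_congr rfl fun j _ => ?_
  have hX := heisX_comp (j := j) hh hN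
  have hY := heisY_comp (j := j) hh hN
  rw [heisX_heisN] at hX
  rw [heisY_heisN] at hY
  unfold heisTest
  rw [hX, hY]
  ring

lemma sqrt_heisGradSq_heisTest_rpow {p : ℝ} (hp : 0 < p) {g : ℝ → ℝ}
    (hg : Differentiable ℝ g) {q : Heisenberg n} (hq : q ≠ 0) :
    √(heisGradSq (heisTest ((2 * n + 2 - p) / (4 * p)) g) q) ^ p =
      heisDensity p q * |4 * (deriv g (Real.log (heisN q)) -
        (2 * n + 2 - p) / (4 * p) * g (Real.log (heisN q)))| ^ p := by
  have hN := heisN_pos hq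
  have hS := heisS_nonneg q
  rw [heisGradSq_heisTest _ hg hq]
  set a : ℝ := (2 * n + 2 - p) / (4 * p) with ha
  set k : ℝ := 4 * (deriv g (Real.log (heisN q)) - a * g (Real.log (heisN q)))
  have hap : -a * p = -((2 * n + 2 - p) / 4) := by
    rw [ha]; field_simp
  rw [Real.sqrt_mul (sq_nonneg _), Real.sqrt_sq_eq_abs, abs_mul,
    abs_of_nonneg (by positivity : 0 ≤ heisN q ^ (-a) / heisN q), Real.sqrt_mul hS]
  have e : heisN q ^ (-a) / heisN q * |k| * (√(heisS q) * √(heisN q)) =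
      √(heisS q) / √(heisN q) * heisN q ^ (-a) * |k| := by
    have h1 := Real.sqrt_pos.2 hN
    have h2 := Real.sq_sqrt hN.le
    field_simp
    rw [h2]
    ring
  rw [e, Real.mul_rpow (by positivity) (abs_nonneg _), Real.mul_rpow (by positivity)
    (by positivity), Real.div_rpow (by positivity) (by positivity), ← Real.rpow_mul hN.le, hap,
    Real.sqrt_eq_rpow (heisN q), ← Real.rpow_mul hN.le, heisDensity,
    show 1 / 2 * p = p / 2 by ring]

lemma weight_mul_abs_heisTest_rpow {p : ℝ} (hp : 0 < p) (g : ℝ → ℝ) {q : Heisenberg n}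
    (hq : q ≠ 0) :
    √(heisS q) ^ p / heisN q ^ (p / 2) * |heisTest ((2 * n + 2 - p) / (4 * p)) g q| ^ p =
      heisDensity p q * |g (Real.log (heisN q))| ^ p := by
  have hN := heisN_pos hq
  have hap : -((2 * n + 2 - p) / (4 * p)) * p = -((2 * n + 2 - p) / 4) := by
    field_simp
  rw [heisTest, abs_mul, abs_of_pos (Real.rpow_pos_of_pos hN _),
    Real.mul_rpow (by positivity) (abs_nonneg _), ← Real.rpow_mul hN.le, hap, heisDensity]
  ring

lemma tsupport_heisTest_subset (a : ℝ) {g : ℝ → ℝ} {M : ℝ}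
    (hM : Function.support g ⊆ Metric.closedBall 0 M) (ha : a ≠ 0) :
    tsupport (heisTest a g : Heisenberg n → ℝ) ⊆
      {q | heisN q ∈ Set.Icc (Real.exp (-M)) (Real.exp M)} := by
  refine closure_minimal (fun q hq => ?_) (isCompact_heisN_preimage_Icc _ _).isClosed
  have hN : 0 < heisN q := by
    refine lt_of_le_of_ne (heisN_nonneg q) fun h => hq ?_
    rw [heisTest, ← h, Real.zero_rpow (neg_ne_zero.2 ha), zero_mul]
  have h1 := hM (right_ne_zero_of_mul hq)
  rw [mem_closedBall_zero_iff, Real.norm_eq_abs, abs_le] at h1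
  exact ⟨(Real.le_log_iff_exp_le hN).1 h1.1, (Real.log_le_iff_le_exp hN).1 h1.2⟩

lemma contDiff_heisTest {a : ℝ} {g : ℝ → ℝ} (hg : ContDiff ℝ (⊤ : ℕ∞) g)
    (h0 : (0 : Heisenberg n) ∉ tsupport (heisTest a g : Heisenberg n → ℝ)) :
    ContDiff ℝ (⊤ : ℕ∞) (heisTest a g : Heisenberg n → ℝ) := by
  refine contDiff_iff_contDiffAt.2 fun q => ?_
  by_cases hq : q = 0
  · subst hq
    exact contDiffAt_const.congr_of_eventuallyEq (notMem_tsupport_iff_eventuallyEq.1 h0)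
  · have hN := (heisN_pos hq).ne'
    have cN : ContDiffAt ℝ (⊤ : ℕ∞) (heisN : Heisenberg n → ℝ) q := contDiff_heisN.contDiffAt
    exact (cN.rpow_const_of_ne hN).mul (hg.contDiffAt.comp q (cN.log hN))

/-- Hardy quotients of the radial test functions reduce to quotients on the line. -/
lemma exists_heisTest_quotient (hn : 1 ≤ n) {p : ℝ} (hp : 0 < p) (hpQ : p < 2 * n + 2)
    {g : ℝ → ℝ} (hg : ContDiff ℝ (⊤ : ℕ∞) g) (hgc : HasCompactSupport g)
    (hg0 : ∫ s, |g s| ^ p ≠ 0) :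
    ∃ φ : Heisenberg n → ℝ, ContDiff ℝ (⊤ : ℕ∞) φ ∧ HasCompactSupport φ ∧
      (0 : Heisenberg n) ∉ tsupport φ ∧
      ∫ q : Heisenberg n, √(heisS q) ^ p / heisN q ^ (p / 2) * |φ q| ^ p ≠ 0 ∧
      (∫ s, |4 * (deriv g s - (2 * n + 2 - p) / (4 * p) * g s)| ^ p) / ∫ s, |g s| ^ p =
        (∫ q, √(heisGradSq φ q) ^ p) /
          ∫ q : Heisenberg n, √(heisS q) ^ p / heisN q ^ (p / 2) * |φ q| ^ p := by
  obtain ⟨c, hc, hpol⟩ := exists_integral_heisDensity_mul hn hp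
  have ha : (2 * n + 2 - p) / (4 * p) ≠ 0 := (div_pos (by linarith) (by linarith)).ne'
  obtain ⟨M, hM⟩ := hgc.isCompact.isBounded.subset_closedBall 0
  have hsub := tsupport_heisTest_subset (n := n) _ ((subset_tsupport g).trans hM) ha
  have h0 : (0 : Heisenberg n) ∉ tsupport (heisTest ((2 * n + 2 - p) / (4 * p)) g) := fun h => by
    have := (Real.exp_pos (-M)).trans_le (hsub h).1
    simp [heisN, heisS] at this
  have hden : ∫ q : Heisenberg n, √(heisS q) ^ p / heisN q ^ (p / 2) *
      |heisTest ((2 * n + 2 - p) / (4 * p)) g q| ^ p = c * ∫ s, |g s| ^ p := by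
    rw [← hpol (fun s => |g s| ^ p) (hg.continuous.abs.rpow_const fun _ => Or.inr hp.le)]
    refine integral_congr_ae ?_
    filter_upwards [ae_ne_zero_heisenberg] with q hq
    exact weight_mul_abs_heisTest_rpow hp g hq
  have hg' : Continuous (deriv g) := hg.continuous_deriv (by simp)
  have hnum : ∫ q : Heisenberg n, √(heisGradSq (heisTest ((2 * n + 2 - p) / (4 * p)) g) q) ^ p =
      c * ∫ s, |4 * (deriv g s - (2 * n + 2 - p) / (4 * p) * g s)| ^ p := by
    rw [← hpol (fun s => |4 * (deriv g s - (2 * n + 2 - p) / (4 * p) * g s)| ^ p)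
      ((continuous_const.mul (hg'.sub (continuous_const.mul hg.continuous))).abs.rpow_const
        fun _ => Or.inr hp.le)]
    refine integral_congr_ae ?_
    filter_upwards [ae_ne_zero_heisenberg] with q hq
    exact sqrt_heisGradSq_heisTest_rpow hp (hg.differentiable (by simp)) hq
  refine ⟨_, contDiff_heisTest hg h0,
    HasCompactSupport.of_support_subset_isCompact (isCompact_heisN_preimage_Icc _ _)
      ((subset_tsupport _).trans hsub), h0, ?_, ?_⟩
  · rw [hden]
    exact mul_ne_zero hc.ne' hg0
  · rw [hden, hnum, mul_div_mul_left _ _ hc.ne']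

end TestFunctions

/-- Spreading a profile `η` out to `s ↦ η (ε s)` makes its derivative negligible. -/
lemma tendsto_integral_dilated_deriv {p : ℝ} (hp : 0 < p) (a : ℝ) {η : ℝ → ℝ}
    (hη : ContDiff ℝ 1 η) (hηc : HasCompactSupport η) :
    Tendsto (fun ε : ℝ => ∫ s, |4 * (ε * deriv η s - a * η s)| ^ p) (𝓝 0)
      (𝓝 (|4 * a| ^ p * ∫ s, |η s| ^ p)) := by
  have hη' : Continuous (deriv η) := hη.continuous_deriv le_rfl
  have hcont : Continuous fun x : ℝ × ℝ => |4 * (x.1 * deriv η x.2 - a * η x.2)| ^ p := by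
    have := hη.continuous
    exact Continuous.rpow_const (by fun_prop) fun _ => Or.inr hp.le
  have hJ : Continuous fun ε : ℝ => ∫ s, |4 * (ε * deriv η s - a * η s)| ^ p := by
    refine (continuous_parametric_integral_of_continuous (μ := volume)
      (f := fun ε s => |4 * (ε * deriv η s - a * η s)| ^ p) hcont hηc.isCompact).congr fun ε => ?_
    refine setIntegral_eq_integral_of_forall_compl_eq_zero fun s hs => ?_
    have h1 : η s = 0 := image_eq_zero_of_notMem_tsupport hs
    have h2 : deriv η s = 0 := by
      by_contra h
      exact hs (support_deriv_subset h)
    simp [h1, h2, hp.ne']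
  convert hJ.tendsto 0 using 2
  rw [← integral_const_mul]
  congr 1 with s
  rw [← Real.mul_rpow (abs_nonneg _) (abs_nonneg _), ← abs_mul, ← abs_neg]
  congr 2
  ring

lemma integral_comp_dilation_quotient {p ε : ℝ} (hε : 0 < ε) (a : ℝ) {η : ℝ → ℝ} :
    (∫ s, |4 * (deriv (fun s => η (ε * s)) s - a * η (ε * s))| ^ p) /
        ∫ s, |η (ε * s)| ^ p =
      (∫ s, |4 * (ε * deriv η s - a * η s)| ^ p) / ∫ s, |η s| ^ p := by
  have h1 := Measure.integral_comp_mul_left (fun s => |4 * (ε * deriv η s - a * η s)| ^ p) ε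
  have h2 := Measure.integral_comp_mul_left (fun s => |η s| ^ p) ε
  simp only [deriv_comp_mul_left, smul_eq_mul] at h1 h2 ⊢
  rw [h1, h2, mul_div_mul_left]
  exact abs_ne_zero.2 (inv_ne_zero hε.ne')

/-- **Sharpness of the constant in the Heisenberg L^p Hardy inequality**:
the infimum of the Hardy quotients over smooth `φ` compactly supported in
`ℝ^{2n+1} \ {0}` with nonvanishing weighted denominator equals
`((Q-p)/p)^p` where `Q = 2n+2`. -/
theorem hardy_constant_sharp_heisenberg (n : ℕ) (hn : 1 ≤ n) (p : ℝ)
    (hp1 : 1 < p) (hpQ : p < 2 * n + 2) :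
    IsGLB {r : ℝ | ∃ φ : Heisenberg n → ℝ,
        ContDiff ℝ (⊤ : ℕ∞) φ ∧ HasCompactSupport φ ∧
        (0 : Heisenberg n) ∉ tsupport φ ∧
        (∫ q : Heisenberg n,
          (Real.sqrt (‖q.1‖ ^ 2 + ‖q.2.1‖ ^ 2)) ^ p /
            ((‖q.1‖ ^ 2 + ‖q.2.1‖ ^ 2) ^ 2 + q.2.2 ^ 2) ^ (p / 2) *
              |φ q| ^ p) ≠ 0 ∧
        r = (∫ q, (Real.sqrt (heisGradSq φ q)) ^ p) /
            (∫ q : Heisenberg n,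
              (Real.sqrt (‖q.1‖ ^ 2 + ‖q.2.1‖ ^ 2)) ^ p /
                ((‖q.1‖ ^ 2 + ‖q.2.1‖ ^ 2) ^ 2 + q.2.2 ^ 2) ^ (p / 2) *
                  |φ q| ^ p)}
      (((2 * n + 2 - p) / p) ^ p) := by
  have hp : 0 < p := one_pos.trans hp1
  constructor
  · rintro r ⟨φ, hφ, hc, h0, hden, rfl⟩
    have hden' : 0 ≤ ∫ q : Heisenberg n,
        √(heisS q) ^ p / heisN q ^ (p / 2) * |φ q| ^ p :=
      integral_nonneg fun q => mul_nonneg (div_nonneg (Real.rpow_nonneg (Real.sqrt_nonneg _) _)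
        (Real.rpow_nonneg (heisN_nonneg q) _)) (Real.rpow_nonneg (abs_nonneg _) _)
    exact (le_div_iff₀ (lt_of_le_of_ne hden' hden.symm)).2
      (heisenberg_hardy_inequality hp1 hpQ (hφ.of_le (by simp)) hc h0)
  · intro b hb
    let η : ContDiffBump (0 : ℝ) := ⟨1, 2, one_pos, one_lt_two⟩
    have hη : ContDiff ℝ (⊤ : ℕ∞) η := η.contDiff
    have hηc : HasCompactSupport η := η.hasCompactSupport
    have hI : 0 < ∫ s, |η s| ^ p := by
      refine Continuous.integral_pos_of_hasCompactSupport_nonneg_nonzero (x := 0)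
        (hη.continuous.abs.rpow_const fun _ => Or.inr hp.le) ?_
        (fun s => Real.rpow_nonneg (abs_nonneg _) _) ?_
      · exact hηc.comp_left (g := fun x => |x| ^ p) (by simp [hp.ne'])
      · have : η 0 = 1 := η.one_of_mem_closedBall (Metric.mem_closedBall_self η.rIn_pos.le)
        simp [this]
    set a : ℝ := (2 * n + 2 - p) / (4 * p) with ha
    have ha0 : 0 < a := div_pos (by linarith) (by linarith)
    have hlim := ((tendsto_integral_dilated_deriv hp a (hη.of_le (by simp)) hηc).mono_left
      (nhdsWithin_le_nhds (s := Set.Ioi 0))).div_const (∫ s, |η s| ^ p)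
    rw [mul_div_cancel_right₀ _ hI.ne', abs_of_pos (by positivity),
      show 4 * a = (2 * n + 2 - p) / p by rw [ha]; field_simp] at hlim
    refine ge_of_tendsto hlim (eventually_nhdsWithin_of_forall fun ε hε => hb ?_)
    have hε0 : 0 < ε := hε
    have hgI : ∫ s, |η (ε * s)| ^ p ≠ 0 := by
      rw [Measure.integral_comp_mul_left (fun s => |η s| ^ p) ε]
      exact smul_ne_zero (abs_ne_zero.2 (inv_ne_zero hε0.ne')) hI.ne'
    obtain ⟨φ, h1, h2, h3, h4, h5⟩ := exists_heisTest_quotient hn hp hpQ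
      (g := fun s => η (ε * s)) (hη.comp (contDiff_const.mul contDiff_id))
      (hηc.comp_homeomorph (Homeomorph.mulLeft₀ ε hε0.ne')) hgI
    refine ⟨φ, h1, h2, h3, h4, ?_⟩
    exact (integral_comp_dilation_quotient hε0 a).symm.trans h5
end

section
/- Let n ≥ 1 and Q = 2n + 2. The function u(z,t) = ρ(z,t)^{2−Q}, with ρ(z,t) = (|z|⁴ + t²)^{1/4}, is harmonic for the Heisenberg sub-Laplacian away from the origin: at every point (z, t) ∈ ℝ^{2n+1} with (z, t) ≠ 0, Σ_{j=1}^n [X_j(X_j u) + Y_j(Y_j u)] = 0. -/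
open MeasureTheory

/-- The fourth power `|z|⁴ + t²` of the homogeneous norm. -/
noncomputable def heisGauge {n : ℕ} (q : Heisenberg n) : ℝ :=
  (‖q.1‖ ^ 2 + ‖q.2.1‖ ^ 2) ^ 2 + q.2.2 ^ 2

lemma heisGauge_pos {n : ℕ} {q : Heisenberg n} (hq : q ≠ 0) : 0 < heisGauge q := by
  unfold heisGauge
  by_contra! h
  have ht : q.2.2 ^ 2 = 0 := by nlinarith [sq_nonneg q.2.2, sq_nonneg (‖q.1‖ ^ 2 + ‖q.2.1‖ ^ 2)]
  have hs : (‖q.1‖ ^ 2 + ‖q.2.1‖ ^ 2) ^ 2 = 0 := by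
    nlinarith [sq_nonneg q.2.2, sq_nonneg (‖q.1‖ ^ 2 + ‖q.2.1‖ ^ 2)]
  have hz : ‖q.1‖ ^ 2 + ‖q.2.1‖ ^ 2 = 0 := by simpa using hs
  have hx : ‖q.1‖ ^ 2 = 0 := by nlinarith [sq_nonneg ‖q.1‖, sq_nonneg ‖q.2.1‖]
  have hy : ‖q.2.1‖ ^ 2 = 0 := by nlinarith [sq_nonneg ‖q.1‖, sq_nonneg ‖q.2.1‖]
  apply hq
  refine Prod.ext ?_ (Prod.ext ?_ ?_)
  · simpa using hx
  · simpa using hy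
  · simpa using ht

lemma heisRho_rpow {n : ℕ} (q : Heisenberg n) (a : ℝ) :
    heisRho q ^ a = heisGauge q ^ (a / 4) := by
  have h : 0 ≤ heisGauge q := by unfold heisGauge; positivity
  change (heisGauge q ^ ((1 : ℝ) / 4)) ^ a = _
  rw [← Real.rpow_mul h]
  ring_nf

lemma differentiable_heisGauge {n : ℕ} : Differentiable ℝ (heisGauge (n := n)) := by
  unfold heisGauge
  have h1 : Differentiable ℝ (fun q : Heisenberg n => ‖q.1‖ ^ 2) := differentiable_fst.norm_sq ℝ
  have h2 : Differentiable ℝ (fun q : Heisenberg n => ‖q.2.1‖ ^ 2) :=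
    (differentiable_fst.comp differentiable_snd).norm_sq ℝ
  fun_prop

lemma hasFDerivAt_coord_x {n : ℕ} (j : Fin n) (q : Heisenberg n) :
    HasFDerivAt (fun w : Heisenberg n => w.1 j)
      ((EuclideanSpace.proj j).comp (ContinuousLinearMap.fst ℝ _ _)) q :=
  (EuclideanSpace.proj j : EuclideanSpace ℝ (Fin n) →L[ℝ] ℝ).hasFDerivAt.comp q hasFDerivAt_fst

lemma hasFDerivAt_coord_y {n : ℕ} (j : Fin n) (q : Heisenberg n) :
    HasFDerivAt (fun w : Heisenberg n => w.2.1 j)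
      ((EuclideanSpace.proj j).comp ((ContinuousLinearMap.fst ℝ _ _).comp
        (ContinuousLinearMap.snd ℝ _ _))) q :=
  (EuclideanSpace.proj j : EuclideanSpace ℝ (Fin n) →L[ℝ] ℝ).hasFDerivAt.comp q
    (hasFDerivAt_fst.comp q hasFDerivAt_snd)

lemma hasFDerivAt_coord_t {n : ℕ} (q : Heisenberg n) :
    HasFDerivAt (fun w : Heisenberg n => w.2.2)
      ((ContinuousLinearMap.snd ℝ _ _).comp (ContinuousLinearMap.snd ℝ _ _)) q :=
  hasFDerivAt_snd.comp q hasFDerivAt_snd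

lemma hasFDerivAt_norm_sq_add_norm_sq {n : ℕ} (q : Heisenberg n) :
    ∃ L : Heisenberg n →L[ℝ] ℝ,
      HasFDerivAt (fun w : Heisenberg n => ‖w.1‖ ^ 2 + ‖w.2.1‖ ^ 2) L q ∧
      ∀ v, L v = 2 * (inner ℝ q.1 v.1 + inner ℝ q.2.1 v.2.1) := by
  have h1 := (hasFDerivAt_fst (𝕜 := ℝ) (p := q)).norm_sq
  have h2 := ((hasFDerivAt_fst (𝕜 := ℝ) (p := q.2)).comp q
    (hasFDerivAt_snd (𝕜 := ℝ) (p := q))).norm_sq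
  refine ⟨_, h1.add h2, fun v => ?_⟩
  simp
  ring

lemma fderiv_heisGauge {n : ℕ} (q v : Heisenberg n) :
    fderiv ℝ heisGauge q v =
      4 * (‖q.1‖ ^ 2 + ‖q.2.1‖ ^ 2) * (inner ℝ q.1 v.1 + inner ℝ q.2.1 v.2.1)
        + 2 * q.2.2 * v.2.2 := by
  obtain ⟨L, hL, hv⟩ := hasFDerivAt_norm_sq_add_norm_sq q
  have h : HasFDerivAt (heisGauge (n := n)) _ q := (hL.pow 2).add ((hasFDerivAt_coord_t q).pow 2)
  rw [h.fderiv]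
  simp [hv]
  ring

lemma heisX_heisGauge {n : ℕ} (j : Fin n) (q : Heisenberg n) :
    heisX j heisGauge q = 4 * ((‖q.1‖ ^ 2 + ‖q.2.1‖ ^ 2) * q.1 j + q.2.2 * q.2.1 j) := by
  simp [heisX, fderiv_heisGauge, EuclideanSpace.inner_single_right]
  ring

lemma heisY_heisGauge {n : ℕ} (j : Fin n) (q : Heisenberg n) :
    heisY j heisGauge q = 4 * ((‖q.1‖ ^ 2 + ‖q.2.1‖ ^ 2) * q.2.1 j - q.2.2 * q.1 j) := by
  simp [heisY, fderiv_heisGauge, EuclideanSpace.inner_single_right]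
  ring

lemma hasFDerivAt_heisX_heisGauge {n : ℕ} (j : Fin n) (q : Heisenberg n) :
    ∃ L : Heisenberg n →L[ℝ] ℝ, HasFDerivAt (heisX j heisGauge) L q ∧
      L (EuclideanSpace.single j 1, 0, 2 * q.2.1 j) =
        4 * (‖q.1‖ ^ 2 + ‖q.2.1‖ ^ 2) + 8 * (q.1 j ^ 2 + q.2.1 j ^ 2) := by
  obtain ⟨L, hL, hv⟩ := hasFDerivAt_norm_sq_add_norm_sq q
  rw [funext (heisX_heisGauge j)]
  refine ⟨_, ((hL.mul (hasFDerivAt_coord_x j q)).add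
    ((hasFDerivAt_coord_t q).mul (hasFDerivAt_coord_y j q))).const_mul 4, ?_⟩
  simp [hv, EuclideanSpace.inner_single_right]
  ring

lemma hasFDerivAt_heisY_heisGauge {n : ℕ} (j : Fin n) (q : Heisenberg n) :
    ∃ L : Heisenberg n →L[ℝ] ℝ, HasFDerivAt (heisY j heisGauge) L q ∧
      L (0, EuclideanSpace.single j 1, -(2 * q.1 j)) =
        4 * (‖q.1‖ ^ 2 + ‖q.2.1‖ ^ 2) + 8 * (q.1 j ^ 2 + q.2.1 j ^ 2) := by
  obtain ⟨L, hL, hv⟩ := hasFDerivAt_norm_sq_add_norm_sq q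
  rw [funext (heisY_heisGauge j)]
  refine ⟨_, ((hL.mul (hasFDerivAt_coord_y j q)).sub
    ((hasFDerivAt_coord_t q).mul (hasFDerivAt_coord_x j q))).const_mul 4, ?_⟩
  simp [hv, EuclideanSpace.inner_single_right]
  ring

/-- Second derivative of `f ^ a` along a vector field `V`, where `f q > 0`. -/
lemma fderiv_fderiv_rpow_along {E : Type*} [NormedAddCommGroup E] [NormedSpace ℝ E]
    {f : E → ℝ} (hf : Differentiable ℝ f) {V : E → E} {q : E} (hq : 0 < f q) {L : E →L[ℝ] ℝ}
    (hL : HasFDerivAt (fun w => fderiv ℝ f w (V w)) L q) (a : ℝ) :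
    fderiv ℝ (fun w => fderiv ℝ (fun p => f p ^ a) w (V w)) q (V q) =
      a * f q ^ (a - 2) * ((a - 1) * fderiv ℝ f q (V q) ^ 2 + f q * L (V q)) := by
  have hfirst : (fun w => fderiv ℝ (fun p => f p ^ a) w (V w)) =ᶠ[nhds q]
      fun w => a * f w ^ (a - 1) * fderiv ℝ f w (V w) := by
    filter_upwards [hf.continuous.continuousAt.eventually (lt_mem_nhds hq)] with w hw
    rw [((hf w).hasFDerivAt.rpow_const (p := a) (Or.inl hw.ne')).fderiv]
    simp
  have hpow := (hf q).hasFDerivAt.rpow_const (p := a - 1) (Or.inl hq.ne')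
  have hsub : f q ^ (a - 1) = f q ^ (a - 2) * f q := by
    rw [← Real.rpow_add_one hq.ne']
    ring_nf
  have hprod : HasFDerivAt (fun w => a * f w ^ (a - 1) * fderiv ℝ f w (V w)) _ q :=
    (hpow.const_mul a).mul hL
  rw [hfirst.fderiv_eq, hprod.fderiv]
  simp only [add_apply, smul_apply, smul_eq_mul]
  rw [hsub, show a - 1 - 1 = a - 2 by ring]
  ring

lemma sum_sq_add_sq {n : ℕ} (q : Heisenberg n) :
    ∑ j : Fin n, (q.1 j ^ 2 + q.2.1 j ^ 2) = ‖q.1‖ ^ 2 + ‖q.2.1‖ ^ 2 := by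
  rw [Finset.sum_add_distrib, EuclideanSpace.real_norm_sq_eq, EuclideanSpace.real_norm_sq_eq]

/-- The sub-Laplacian of a power of the gauge `|z|⁴ + t²`, away from the origin. -/
lemma subLaplacian_heisGauge_rpow {n : ℕ} {q : Heisenberg n} (hq : q ≠ 0) (a : ℝ) :
    ∑ j : Fin n, (heisX j (heisX j (fun w => heisGauge w ^ a)) q +
        heisY j (heisY j (fun w => heisGauge w ^ a)) q) =
      8 * a * (n + 2 * a) * (‖q.1‖ ^ 2 + ‖q.2.1‖ ^ 2) * heisGauge q ^ (a - 1) := by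
  have hpos := heisGauge_pos hq
  have hterm (j : Fin n) : heisX j (heisX j (fun w => heisGauge w ^ a)) q +
        heisY j (heisY j (fun w => heisGauge w ^ a)) q =
      a * heisGauge q ^ (a - 1) * (8 * (‖q.1‖ ^ 2 + ‖q.2.1‖ ^ 2) +
        16 * a * (q.1 j ^ 2 + q.2.1 j ^ 2)) := by
    obtain ⟨L, hL, hLv⟩ := hasFDerivAt_heisX_heisGauge j q
    obtain ⟨M, hM, hMv⟩ := hasFDerivAt_heisY_heisGauge j q
    have hX := fderiv_fderiv_rpow_along differentiable_heisGauge
      (V := fun w => (EuclideanSpace.single j 1, 0, 2 * w.2.1 j)) hpos hL a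
    have hY := fderiv_fderiv_rpow_along differentiable_heisGauge
      (V := fun w => (0, EuclideanSpace.single j 1, -(2 * w.1 j))) hpos hM a
    have hX' := heisX_heisGauge j q
    have hY' := heisY_heisGauge j q
    unfold heisX at hX' ⊢
    unfold heisY at hY' ⊢
    have hsub : heisGauge q ^ (a - 1) = heisGauge q ^ (a - 2) * heisGauge q := by
      rw [← Real.rpow_add_one hpos.ne']
      ring_nf
    rw [hX, hY, hX', hY', hLv, hMv, hsub]
    generalize heisGauge q ^ (a - 2) = c
    unfold heisGauge
    ring
  rw [Finset.sum_congr rfl fun j _ => hterm j, ← Finset.mul_sum, Finset.sum_add_distrib,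
    ← Finset.mul_sum, ← Finset.mul_sum, sum_sq_add_sq]
  simp
  ring

/-- **Folland's fundamental solution**: `u = ρ^{2−Q}` with `Q = 2n+2` is
harmonic for the Heisenberg sub-Laplacian `Δ_H = Σⱼ (Xⱼ² + Yⱼ²)` away from
the origin. -/
theorem heis_fundamental_solution_harmonic (n : ℕ) (hn : 1 ≤ n)
    (q : Heisenberg n) (hq : q ≠ 0) :
    ∑ j : Fin n,
        (heisX j (heisX j (fun w => heisRho w ^ ((2 : ℝ) - (2 * n + 2)))) q +
         heisY j (heisY j (fun w => heisRho w ^ ((2 : ℝ) - (2 * n + 2)))) q) = 0 := by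
  simp only [heisRho_rpow]
  rw [subLaplacian_heisGauge_rpow hq]
  ring
end
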